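/- arXiv:2408.04196 — 5 statements merged into one kernel-verified Lean document; each statement's English description precedes it below -/
import Mathlib

section
/- Let G be a finite group with exponent m, let g ∈ G, and let l be an integer coprime to m. Then S(g^l) = S(g); that is, the column sum of the character table is constant on conjugacy classes that differ by the Galois (power) action g ↦ g^l. -/
open CategoryTheory Finset

/-- The column sum `S(g) = χ₁(g) + ⋯ + χ_N(g)` of a family of characters. -/
noncomputable def colSum {G : Type} [Group G] [Fintype G] {N : ℕ}
    (χ : Fin N → FDRep ℂ G) (g : G) : ℂ :=
  ∑ t, (χ t).character g

/-- A ring homomorphism into an algebraically closed field extends along an algebraic extension. -/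
theorem exists_ringHom_comp_eq_of_isAlgebraic {A L M : Type*} [CommRing A] [IsDomain A]
    [Field L] [Field M] [IsAlgClosed M] [Algebra A L] [FaithfulSMul A L] [Algebra.IsAlgebraic A L]
    {φ : A →+* M} (hφ : Function.Injective φ) :
    ∃ σ : L →+* M, σ.comp (algebraMap A L) = φ := by
  let := φ.toAlgebra
  have : FaithfulSMul A M := (faithfulSMul_iff_algebraMap_injective A M).mpr hφ
  exact ⟨(IsAlgClosed.lift : L →ₐ[A] M).toRingHom, AlgHom.comp_algebraMap _⟩

/-- An endomorphism of a subfield `K` of an algebraically closed field `L` extends to `L`. -/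
theorem exists_ringHom_comp_eq {K L : Type*} [Field K] [Field L] [IsAlgClosed L]
    (j : K →+* L) (τ : K →+* K) : ∃ σ : L →+* L, σ.comp j = j.comp τ := by
  let := j.toAlgebra
  obtain ⟨s, hs⟩ := exists_isTranscendenceBasis K L
  have := hs.isAlgebraic
  let φ : Algebra.adjoin K (Set.range ((↑) : s → L)) →+* L :=
    ((MvPolynomial.aeval ((↑) : s → L)).toRingHom.comp (MvPolynomial.map τ)).comp
      hs.1.aevalEquiv.symm.toRingEquiv.toRingHom
  have hφ : Function.Injective φ :=
    (Function.Injective.comp hs.1 (MvPolynomial.map_injective τ τ.injective)).comp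
      hs.1.aevalEquiv.symm.injective
  obtain ⟨σ, hσ⟩ := exists_ringHom_comp_eq_of_isAlgebraic (L := L) hφ
  refine ⟨σ, RingHom.ext fun x => ?_⟩
  have h := congrArg (fun f => f (algebraMap K _ x)) hσ
  have hx : φ (algebraMap K _ x) = j (τ x) := by
    change MvPolynomial.aeval _ (MvPolynomial.map τ (hs.1.aevalEquiv.symm _)) = _
    rw [AlgEquiv.commutes, MvPolynomial.algebraMap_eq, MvPolynomial.map_C, MvPolynomial.aeval_C]
    rfl
  exact h.trans hx

/-- For `k` coprime to `m`, some field endomorphism of `ℂ` acts on `m`-th roots of unity by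
`x ↦ x ^ k`. -/
theorem exists_ringHom_rootsOfUnity_pow {m k : ℕ} [NeZero m] (hk : k.Coprime m) :
    ∃ σ : ℂ →+* ℂ, ∀ x : ℂ, x ^ m = 1 → σ x = x ^ k := by
  have : IsCyclotomicExtension {m} ℚ (CyclotomicField m ℚ) :=
    CyclotomicField.isCyclotomicExtension m ℚ
  let j : CyclotomicField m ℚ →+* ℂ :=
    (IsAlgClosed.lift : CyclotomicField m ℚ →ₐ[ℚ] ℂ).toRingHom
  let u := ZMod.unitOfCoprime k hk
  let τ := (IsCyclotomicExtension.Rat.galEquivZMod m (CyclotomicField m ℚ)).symm u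
  obtain ⟨σ, hσ⟩ := exists_ringHom_comp_eq j τ.toRingEquiv.toRingHom
  refine ⟨σ, fun x hx => ?_⟩
  have hζ := IsCyclotomicExtension.zeta_spec m ℚ (CyclotomicField m ℚ)
  obtain ⟨a, -, rfl⟩ := (hζ.map_of_injective j.injective).eq_pow_of_pow_eq_one hx
  rw [← map_pow]
  set y := IsCyclotomicExtension.zeta m ℚ (CyclotomicField m ℚ) ^ a with hy
  have hym : y ^ m = 1 := by rw [hy, pow_right_comm, hζ.pow_eq_one, one_pow]
  have hτ : τ y = y ^ k := by
    rw [IsCyclotomicExtension.Rat.galEquivZMod_apply_of_pow_eq m (CyclotomicField m ℚ) τ hym]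
    simp only [τ, MulEquiv.apply_symm_apply, u, ZMod.coe_unitOfCoprime, ZMod.val_natCast]
    exact (pow_eq_pow_mod k hym).symm
  have h := congrArg (fun f => f y) hσ
  simpa [hτ] using h

/-- An endomorphism of finite order over `ℂ` has an eigenbasis. -/
theorem exists_eigenbasis_of_pow_eq_one {V : Type*} [AddCommGroup V] [Module ℂ V]
    [FiniteDimensional ℂ V] {m : ℕ} [NeZero m] {f : Module.End ℂ V} (hf : f ^ m = 1) :
    ∃ (ι : Type) (_ : Fintype ι) (b : Module.Basis ι ℂ V) (μ : ι → ℂ),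
      ∀ i, f (b i) = μ i • b i := by
  classical
  have hss : f.IsSemisimple := by
    refine Module.End.isSemisimple_of_squarefree_aeval_eq_zero
      (p := Polynomial.X ^ m - Polynomial.C 1) ?_ (by simp [hf])
    exact (Polynomial.separable_X_pow_sub_C (1 : ℂ) (NeZero.ne _) one_ne_zero).squarefree
  have htop : ⨆ μ, f.eigenspace μ = ⊤ := by
    rw [← Module.End.iSup_maxGenEigenspace_eq_top f]
    exact iSup_congr fun μ =>
      (hss.isFinitelySemisimple.maxGenEigenspace_eq_eigenspace μ).symm
  have hint : DirectSum.IsInternal f.eigenspace :=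
    DirectSum.isInternal_submodule_of_iSupIndep_of_iSup_eq_top f.eigenspaces_iSupIndep htop
  let b := hint.collectedBasis fun μ => Module.finBasis ℂ (f.eigenspace μ)
  exact ⟨_, FiniteDimensional.fintypeBasisIndex b, b, fun i => i.1, fun i =>
    Module.End.mem_eigenspace_iff.mp (hint.collectedBasis_mem _ i)⟩

theorem trace_eq_sum_of_eigenbasis {K V ι : Type*} [Field K] [AddCommGroup V] [Module K V]
    [Fintype ι] (b : Module.Basis ι K V) {f : Module.End K V} {μ : ι → K}
    (hb : ∀ i, f (b i) = μ i • b i) : LinearMap.trace K V f = ∑ i, μ i := by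
  classical
  rw [LinearMap.trace_eq_matrix_trace K b]
  simp [Matrix.trace, LinearMap.toMatrix_apply, hb]

theorem trace_pow_eq_map_trace {V : Type*} [AddCommGroup V] [Module ℂ V]
    [FiniteDimensional ℂ V] {m k : ℕ} [NeZero m] {f : Module.End ℂ V} (hf : f ^ m = 1)
    {σ : ℂ →+* ℂ} (hσ : ∀ x : ℂ, x ^ m = 1 → σ x = x ^ k) :
    LinearMap.trace ℂ V (f ^ k) = σ (LinearMap.trace ℂ V f) := by
  obtain ⟨ι, _, b, μ, hb⟩ := exists_eigenbasis_of_pow_eq_one hf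
  have hpow (n : ℕ) (i : ι) : (f ^ n) (b i) = μ i ^ n • b i := by
    induction n with
    | zero => simp
    | succ n ih => rw [pow_succ, Module.End.mul_apply, hb, map_smul, ih, smul_smul, pow_succ']
  have hμ (i : ι) : μ i ^ m = 1 := by
    have h := hpow m i
    rw [hf, Module.End.one_apply] at h
    refine smul_left_injective ℂ (b.ne_zero i) ?_
    simpa using h.symm
  rw [trace_eq_sum_of_eigenbasis b (hpow k), trace_eq_sum_of_eigenbasis b hb, map_sum]
  exact Finset.sum_congr rfl fun i _ => (hσ _ (hμ i)).symm

namespace FDRep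

variable {G : Type} [Group G]

/-- The conjugate of a representation by a field endomorphism. -/
theorem exists_character_eq_map (σ : ℂ →+* ℂ) (V : FDRep ℂ G) :
    ∃ W : FDRep ℂ G, ∀ g, W.character g = σ (V.character g) := by
  let b := Module.finBasis ℂ V
  let ρ : Representation ℂ G (Fin (Module.finrank ℂ V) → ℂ) :=
    (((Matrix.toLinAlgEquiv' (R := ℂ)).toMulEquiv.toMonoidHom.comp
      σ.mapMatrix.toMonoidHom).comp (LinearMap.toMatrixAlgEquiv b).toMulEquiv.toMonoidHom).comp V.ρ
  refine ⟨FDRep.of ρ, fun g => ?_⟩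
  change LinearMap.trace ℂ _ (Matrix.toLin' ((LinearMap.toMatrix b b (V.ρ g)).map σ)) = _
  rw [Matrix.trace_toLin'_eq, character, LinearMap.trace_eq_matrix_trace ℂ b]
  simp [Matrix.trace]

theorem character_pow_eq_map {m k : ℕ} [NeZero m] {σ : ℂ →+* ℂ}
    (hσ : ∀ x : ℂ, x ^ m = 1 → σ x = x ^ k) (V : FDRep ℂ G) {g : G} (hg : g ^ m = 1) :
    V.character (g ^ k) = σ (V.character g) := by
  rw [character, map_pow]
  exact trace_pow_eq_map_trace (by rw [← map_pow, hg, map_one]) hσ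

variable [Fintype G]

theorem nonempty_iso_of_character_eq {V W : FDRep ℂ G} [Simple V] [Simple W]
    (h : V.character = W.character) : Nonempty (V ≅ W) := by
  classical
  have := invertibleOfNonzero (NeZero.ne (Nat.card G : ℂ))
  by_contra hVW
  have h₁ := char_orthonormal V W
  have h₂ := char_orthonormal W W
  rw [if_neg hVW, h] at h₁
  rw [if_pos ⟨Iso.refl W⟩, h₁] at h₂
  exact zero_ne_one h₂

theorem simple_of_character_eq_map {σ : ℂ →+* ℂ} {V W : FDRep ℂ G} [hV : Simple V]
    (h : ∀ g, W.character g = σ (V.character g)) : Simple W := by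
  rw [simple_iff_char_is_norm_one] at hV ⊢
  simp only [h, ← map_mul, ← map_sum, hV, map_natCast]

end FDRep

theorem stmt_2 {G : Type} [Group G] [Fintype G] {N : ℕ}
    (χ : Fin N → FDRep ℂ G)
    (hsimple : ∀ t, Simple (χ t))
    (hdistinct : ∀ s t : Fin N, Nonempty (χ s ≅ χ t) → s = t)
    (hcomplete : ∀ W : FDRep ℂ G, Simple W → ∃ t, Nonempty (W ≅ χ t))
    (g : G) (l : ℤ) (hl : IsCoprime l (Monoid.exponent G : ℤ)) :
    colSum χ (g ^ l) = colSum χ g := by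
  set m := Monoid.exponent G
  have : NeZero m := ⟨Monoid.exponent_ne_zero_of_finite⟩
  obtain ⟨k, hk⟩ := Int.eq_ofNat_of_zero_le (Int.emod_nonneg l (NeZero.ne (m : ℤ)))
  have hgk (x : G) : x ^ l = x ^ k := by
    rw [← zpow_natCast, ← hk]
    conv_lhs => rw [← Int.emod_add_mul_ediv l m, zpow_add, zpow_mul, zpow_natCast,
      Monoid.pow_exponent_eq_one, one_zpow, mul_one]
  have hkm : k.Coprime m := by
    rw [← Nat.isCoprime_iff_coprime, ← hk]
    have h := hl.add_mul_right_left (-(l / m))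
    rwa [show l + -(l / m) * m = l % m by linarith [Int.emod_add_mul_ediv l m]] at h
  obtain ⟨σ, hσ⟩ := exists_ringHom_rootsOfUnity_pow hkm
  have hconj (t : Fin N) : ∃ s, ∀ x, (χ s).character x = σ ((χ t).character x) := by
    obtain ⟨W, hW⟩ := FDRep.exists_character_eq_map σ (χ t)
    have := hsimple t
    obtain ⟨s, ⟨e⟩⟩ := hcomplete W (FDRep.simple_of_character_eq_map hW)
    exact ⟨s, fun x => by rw [← FDRep.char_iso e, hW]⟩
  choose π hπ using hconj
  have hπ_inj : Function.Injective π := fun s t hst => by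
    have := hsimple s
    have := hsimple t
    refine hdistinct s t (FDRep.nonempty_iso_of_character_eq (funext fun x => σ.injective ?_))
    rw [← hπ, ← hπ, hst]
  calc colSum χ (g ^ l) = ∑ t, (χ (π t)).character g := by
        rw [hgk]
        exact Finset.sum_congr rfl fun t _ => by
          rw [FDRep.character_pow_eq_map hσ _ (Monoid.pow_exponent_eq_one g), hπ]
    _ = colSum χ g :=
        (Finite.injective_iff_bijective.mp hπ_inj).sum_comp fun t => (χ t).character g
end

section
/- Let m ≥ 3 and let V be a faithful irreducible complex representation of the dihedral group D_{2m} of order 2m. Then for all n ≥ 0: b_V(n) = (2^n/(2m)) · (m + 1 + 2·Σ_{k=1}^{(m−1)/2} cos^n(2πk/m)) if m is odd; b_V(n) = (2^n/(2m)) · (m + 2 + 4·Σ_{k=1}^{(m−2)/4} cos^n(4πk/m)) if m is even and m/2 is odd; and b_V(n) = (2^n/(2m)) · (m + 2 + 2·(−1)^n + 4·Σ_{k=1}^{⌊(m−2)/4⌋} cos^n(4πk/m)) if m is even and m/2 is even, where an empty summation (in particular when m = 4) is taken to be 0. -/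
open CategoryTheory Finset

/-- `bV χ V n = ∑ₜ ⟨χ_V^n, χₜ⟩`, the number of irreducible summands (with multiplicity)
of `V^{⊗n}`, where `⟨φ, ψ⟩ = (1/|G|) ∑_g φ(g) conj(ψ(g))`. -/
noncomputable def bV {G : Type} [Group G] [Fintype G] {N : ℕ}
    (χ : Fin N → FDRep ℂ G) (V : FDRep ℂ G) (n : ℕ) : ℂ :=
  ∑ t, (1 / (Fintype.card G : ℂ)) *
    ∑ g, V.character g ^ n * (starRingEnd ℂ) ((χ t).character g)

namespace FDRep

/-- The one-dimensional representation given by a multiplicative character `G →* ℂ`. -/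
noncomputable def ofMonoidHom {G : Type} [Monoid G] (φ : G →* ℂ) : FDRep ℂ G :=
  FDRep.of ((Algebra.lmul ℂ ℂ : ℂ →* Module.End ℂ ℂ).comp φ)

lemma ofMonoidHom_ρ {G : Type} [Monoid G] (φ : G →* ℂ) (g : G) :
    (ofMonoidHom φ).ρ g = Algebra.lmul ℂ ℂ (φ g) := rfl

lemma character_ofMonoidHom {G : Type} [Monoid G] (φ : G →* ℂ) (g : G) :
    (ofMonoidHom φ).character g = φ g :=
  Algebra.trace_self_apply (R := ℂ) (φ g)

lemma ρ_eq_one_of_iso {G : Type} [Monoid G] {V W : FDRep ℂ G} (i : V ≅ W) {g : G}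
    (h : W.ρ g = 1) : V.ρ g = 1 := by
  rw [FDRep.Iso.conj_ρ i.symm g, h]
  exact LinearEquiv.conj_id _

lemma simple_ofMonoidHom {G : Type} [Group G] [Fintype G] (φ : G →* ℂ) :
    Simple (ofMonoidHom φ) := by
  rw [simple_iff_char_is_norm_one]
  simp_rw [character_ofMonoidHom, ← map_mul, mul_inv_cancel, map_one]
  simp

lemma sum_character_mul_inv_eq_zero_or_iso {G : Type} [Group G] [Fintype G]
    (V W : FDRep ℂ G) [Simple V] [Simple W] :
    ∑ g : G, V.character g * W.character g⁻¹ = 0 ∨ Nonempty (V ≅ W) := by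
  classical
  have := invertibleOfNonzero (NeZero.ne (Nat.card G : ℂ))
  have h := char_orthonormal V W
  by_cases hVW : Nonempty (V ≅ W)
  · exact Or.inr hVW
  · left
    rw [if_neg hVW] at h
    exact (mul_eq_zero.mp h).resolve_left (inv_ne_zero (NeZero.ne _))

/-- The linear functional on functions `G → ℂ` sending the character of a representation to
its number of irreducible summands, for a complete list `χ` of irreducible representations. -/
noncomputable def totalMult {G : Type} [Group G] [Fintype G] {N : ℕ}
    (χ : Fin N → FDRep ℂ G) : (G → ℂ) →ₗ[ℂ] ℂ :=
  ∑ t, (1 / (Fintype.card G : ℂ)) •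
    ∑ g, (starRingEnd ℂ) ((χ t).character g) • LinearMap.proj g

lemma bV_eq_totalMult {G : Type} [Group G] [Fintype G] {N : ℕ}
    (χ : Fin N → FDRep ℂ G) (V : FDRep ℂ G) (n : ℕ) :
    bV χ V n = totalMult χ (V.character ^ n) := by
  simp [bV, totalMult, mul_comm]

end FDRep

namespace DihedralGroup

variable {m : ℕ} [NeZero m]

lemma sum_eq_sum_r_add_sum_sr (f : DihedralGroup m → ℂ) :
    ∑ g, f g = ∑ i, f (r i) + ∑ i, f (sr i) := by
  rw [← equivSum.symm.sum_comp, Fintype.sum_sum_type]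
  rfl

lemma sum_stdAddChar_mul (a : ZMod m) :
    ∑ i : ZMod m, ZMod.stdAddChar (a * i) = if a = 0 then (m : ℂ) else 0 := by
  simp_rw [mul_comm a]
  rw [AddChar.sum_mulShift a (ZMod.isPrimitive_stdAddChar m)]
  simp

lemma stdAddChar_mul_stdAddChar_neg (i : ZMod m) :
    (ZMod.stdAddChar i : ℂ) * ZMod.stdAddChar (-i) = 1 := by
  rw [← AddChar.map_add_eq_mul, add_neg_cancel, AddChar.map_zero_eq_one]

lemma conj_stdAddChar (i : ZMod m) :
    (starRingEnd ℂ) (ZMod.stdAddChar i) = ZMod.stdAddChar (-i) := by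
  rw [AddChar.map_neg_eq_conj]

/-- The linear character `r i ↦ exp (2 π I a i / m)`, `sr i ↦ ε exp (2 π I a i / m)`
for `2a = 0` and `ε² = 1`. -/
noncomputable def linChar (a : ZMod m) (ha : a + a = 0) (ε : ℂ) (hε : ε * ε = 1) :
    DihedralGroup m →* ℂ where
  toFun
    | r i => ZMod.stdAddChar (a * i)
    | sr i => ε * ZMod.stdAddChar (a * i)
  map_one' := by rw [one_def]; simp
  map_mul' := by
    have key (i j : ZMod m) : a * (j - i) = a * i + a * j := by linear_combination -i * ha
    rintro (i | i) (j | j)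
    · simp [mul_add, AddChar.map_add_eq_mul]
    · simp only [r_mul_sr, key, AddChar.map_add_eq_mul]; ring
    · simp only [sr_mul_r, mul_add, AddChar.map_add_eq_mul]; ring
    · simp only [sr_mul_sr, key, AddChar.map_add_eq_mul]
      linear_combination (-ZMod.stdAddChar (a * i) * ZMod.stdAddChar (a * j)) * hε

/-- The matrices of the representation of the dihedral group induced from the character
`i ↦ exp (2 π I a i / m)` of the rotation subgroup. -/
noncomputable def rotMatrix (a : ZMod m) : DihedralGroup m →* Matrix (Fin 2) (Fin 2) ℂ where
  toFun
    | r i => !![ZMod.stdAddChar (a * i), 0; 0, ZMod.stdAddChar (-(a * i))]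
    | sr i => !![0, ZMod.stdAddChar (-(a * i)); ZMod.stdAddChar (a * i), 0]
  map_one' := by rw [one_def]; simp [Matrix.one_fin_two]
  map_mul' := by
    rintro (i | i) (j | j) <;>
    simp [← AddChar.map_add_eq_mul] <;> ring_nf <;> simp

/-- The representation of the dihedral group induced from the character
`i ↦ exp (2 π I a i / m)` of the rotation subgroup. -/
noncomputable def rotRep (a : ZMod m) : FDRep ℂ (DihedralGroup m) :=
  FDRep.of ((Matrix.toLinAlgEquiv' : Matrix (Fin 2) (Fin 2) ℂ ≃ₐ[ℂ] _).toMonoidHom.comp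
    (rotMatrix a))

lemma rotRep_ρ (a : ZMod m) (g : DihedralGroup m) :
    (rotRep a).ρ g = Matrix.toLinAlgEquiv' (rotMatrix a g) := rfl

lemma character_rotRep (a : ZMod m) (g : DihedralGroup m) :
    (rotRep a).character g = (rotMatrix a g).trace :=
  Matrix.trace_toLin'_eq _

@[simp]
lemma character_rotRep_r (a i : ZMod m) :
    (rotRep a).character (r i) = ZMod.stdAddChar (a * i) + ZMod.stdAddChar (-(a * i)) := by
  simp [character_rotRep, rotMatrix, Matrix.trace_fin_two]

@[simp]
lemma character_rotRep_sr (a i : ZMod m) : (rotRep a).character (sr i) = 0 := by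
  simp [character_rotRep, rotMatrix, Matrix.trace_fin_two]

lemma character_rotRep_inv (a : ZMod m) (g : DihedralGroup m) :
    (rotRep a).character g⁻¹ = (rotRep a).character g := by
  rcases g with i | i <;> simp [add_comm]

lemma simple_rotRep {a : ZMod m} (ha : a + a ≠ 0) : Simple (rotRep a) := by
  rw [FDRep.simple_iff_char_is_norm_one, sum_eq_sum_r_add_sum_sr, nat_card]
  have h1 (i : ZMod m) : (rotRep a).character (r i) * (rotRep a).character (r i)⁻¹ =
      ZMod.stdAddChar ((a + a) * i) + ZMod.stdAddChar (-(a + a) * i) + 2 := by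
    rw [character_rotRep_inv, character_rotRep_r, neg_mul, add_mul a a i,
      neg_add, AddChar.map_add_eq_mul, AddChar.map_add_eq_mul]
    linear_combination 2 * stdAddChar_mul_stdAddChar_neg (a * i)
  have hna : -(a + a) ≠ 0 := neg_ne_zero.mpr ha
  simp only [h1, sum_add_distrib, sum_stdAddChar_mul, if_neg ha, if_neg hna]
  simp [mul_comm]

lemma character_rotRep_eq_add (a : ZMod m) (ha : a + a = 0) (g : DihedralGroup m) :
    (rotRep a).character g =
      (FDRep.ofMonoidHom (linChar a ha 1 (by norm_num))).character g +
      (FDRep.ofMonoidHom (linChar a ha (-1) (by norm_num))).character g := by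
  rw [FDRep.character_ofMonoidHom, FDRep.character_ofMonoidHom]
  rcases g with i | i
  · rw [character_rotRep_r, ← neg_mul, neg_eq_of_add_eq_zero_left ha]
    rfl
  · simp [linChar]

lemma exists_sum_character_rotRep_ne_zero (W : FDRep ℂ (DihedralGroup m)) [Simple W] :
    ∃ a : ZMod m, ∑ g, W.character g * (rotRep a).character g⁻¹ ≠ 0 := by
  by_contra! h
  have hr (i : ZMod m) : W.character (r (-i)) = W.character (r i) := by
    have := W.char_conj (r i) (sr 0)
    simpa using this
  have h1 (a : ZMod m) : ∑ i, W.character (r i) * ZMod.stdAddChar (a * i) = 0 := by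
    have h2 := h a
    simp only [character_rotRep_inv, sum_eq_sum_r_add_sum_sr, character_rotRep_r,
      character_rotRep_sr, mul_zero, sum_const_zero, add_zero, mul_add, sum_add_distrib] at h2
    rw [← Equiv.sum_comp (Equiv.neg (ZMod m))
      (fun i ↦ W.character (r i) * ZMod.stdAddChar (-(a * i)))]
      at h2
    simp only [Equiv.neg_apply, hr, mul_neg, neg_neg] at h2
    linear_combination h2 / 2
  have h0 (j : ZMod m) : W.character (r j) = 0 := by
    have h3 : ∑ a : ZMod m, (∑ i, W.character (r i) * ZMod.stdAddChar (a * i)) *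
        ZMod.stdAddChar (a * -j) = 0 := by simp [h1]
    simp_rw [sum_mul] at h3
    rw [sum_comm] at h3
    simp_rw [mul_assoc, ← AddChar.map_add_eq_mul, ← mul_add, ← mul_sum, mul_comm _ (_ + -j),
      sum_stdAddChar_mul, ← sub_eq_add_neg, sub_eq_zero] at h3
    simpa [NeZero.ne] using h3
  have hdim : Module.finrank ℂ W = 0 := by
    have := h0 0
    rwa [r_zero, FDRep.char_one, Nat.cast_eq_zero] at this
  have hchar (g : DihedralGroup m) : W.character g = 0 := by
    have := Module.finrank_zero_iff.mp hdim
    rw [FDRep.character, Subsingleton.elim (W.ρ g) 0, map_zero]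
  have hW := (FDRep.simple_iff_char_is_norm_one W).mp inferInstance
  simp only [hchar, mul_zero, sum_const_zero] at hW
  exact NeZero.ne _ hW.symm

lemma iso_rotRep_or_iso_ofMonoidHom (W : FDRep ℂ (DihedralGroup m)) [Simple W] :
    (∃ a : ZMod m, a + a ≠ 0 ∧ Nonempty (W ≅ rotRep a)) ∨
    (∃ (a : ZMod m) (ha : a + a = 0) (ε : ℂ) (hε : ε * ε = 1), star ε = ε ∧
      Nonempty (W ≅ FDRep.ofMonoidHom (linChar a ha ε hε))) := by
  obtain ⟨a, h⟩ := exists_sum_character_rotRep_ne_zero W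
  by_cases ha : a + a = 0
  · right
    have := FDRep.simple_ofMonoidHom (linChar a ha 1 (by norm_num))
    have := FDRep.simple_ofMonoidHom (linChar a ha (-1) (by norm_num))
    simp only [character_rotRep_eq_add a ha, mul_add, sum_add_distrib] at h
    rcases FDRep.sum_character_mul_inv_eq_zero_or_iso W
      (FDRep.ofMonoidHom (linChar a ha 1 _)) with h1 | h1
    · rcases FDRep.sum_character_mul_inv_eq_zero_or_iso W
        (FDRep.ofMonoidHom (linChar a ha (-1) _)) with h2 | h2
      · simp [h1, h2] at h
      · exact ⟨a, ha, -1, _, by simp, h2⟩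
    · exact ⟨a, ha, 1, _, by simp, h1⟩
  · left
    have := simple_rotRep ha
    exact ⟨a, ha, (FDRep.sum_character_mul_inv_eq_zero_or_iso W _).resolve_left h⟩

lemma conj_character (W : FDRep ℂ (DihedralGroup m)) [Simple W] (g : DihedralGroup m) :
    (starRingEnd ℂ) (W.character g) = W.character g⁻¹ := by
  rcases iso_rotRep_or_iso_ofMonoidHom W with ⟨a, -, ⟨i⟩⟩ | ⟨a, ha, ε, hε, hε', ⟨i⟩⟩
  · rw [FDRep.char_iso i, character_rotRep_inv]
    rcases g with i | i <;> simp [conj_stdAddChar, add_comm]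
  · rw [FDRep.char_iso i, FDRep.character_ofMonoidHom, FDRep.character_ofMonoidHom]
    rcases g with i | i
    · simp [linChar, conj_stdAddChar]
    · rw [inv_sr]
      have : (starRingEnd ℂ) ε = ε := hε'
      simp [linChar, conj_stdAddChar, this, ← neg_mul, neg_eq_of_add_eq_zero_left ha]

lemma exists_isUnit_iso_rotRep (hm : 3 ≤ m) (V : FDRep ℂ (DihedralGroup m)) [Simple V]
    (hV : Function.Injective V.ρ) : ∃ a : ZMod m, IsUnit a ∧ Nonempty (V ≅ rotRep a) := by
  have h2 : (2 : ZMod m) ≠ 0 := by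
    intro h
    have := (ZMod.natCast_eq_zero_iff 2 m).mp (by exact_mod_cast h)
    exact absurd (Nat.le_of_dvd (by norm_num) this) (by omega)
  have hr {k : ZMod m} (h : V.ρ (r k) = 1) : k = 0 := by
    rw [← map_one V.ρ, one_def] at h
    simpa using r.inj (hV h)
  rcases iso_rotRep_or_iso_ofMonoidHom V with ⟨a, -, ⟨i⟩⟩ | ⟨a, ha, ε, hε, hε', ⟨i⟩⟩
  · refine ⟨a, ?_, ⟨i⟩⟩
    refine (isUnit_iff_mem_nonZeroDivisors_of_finite).mpr ?_
    refine mem_nonZeroDivisors_iff_right.mpr fun k hk ↦ hr (FDRep.ρ_eq_one_of_iso i ?_)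
    rw [rotRep_ρ]
    simp [rotMatrix, mul_comm a k, hk, ← Matrix.one_fin_two]
    rfl
  · refine absurd (hr (FDRep.ρ_eq_one_of_iso i ?_)) h2
    have : linChar a ha ε hε (r 2) = 1 := by simp [linChar, mul_two, ha]
    rw [FDRep.ofMonoidHom_ρ, this, map_one]
    rfl

section TotalMult

variable {N : ℕ} {χ : Fin N → FDRep ℂ (DihedralGroup m)}

lemma totalMult_character_of_simple (hsimple : ∀ t, Simple (χ t))
    (hdistinct : ∀ s t : Fin N, Nonempty (χ s ≅ χ t) → s = t)
    (hcomplete : ∀ W : FDRep ℂ (DihedralGroup m), Simple W → ∃ t, Nonempty (W ≅ χ t))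
    (L : FDRep ℂ (DihedralGroup m)) [Simple L] : FDRep.totalMult χ L.character = 1 := by
  classical
  have := invertibleOfNonzero (NeZero.ne (Nat.card (DihedralGroup m) : ℂ))
  obtain ⟨s, ⟨i⟩⟩ := hcomplete L inferInstance
  have key (t : Fin N) : (Nat.card (DihedralGroup m) : ℂ)⁻¹ *
      ∑ g, (starRingEnd ℂ) ((χ t).character g) * L.character g = if s = t then 1 else 0 := by
    have ht := hsimple t
    have hs := hsimple s
    have h := FDRep.char_orthonormal (χ s) (χ t)
    have hst : Nonempty (χ s ≅ χ t) ↔ s = t :=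
      ⟨hdistinct s t, fun h ↦ h ▸ ⟨Iso.refl _⟩⟩
    simp only [hst] at h
    simpa only [FDRep.char_iso i, conj_character, mul_comm] using h
  simp only [FDRep.totalMult, LinearMap.sum_apply, LinearMap.smul_apply, LinearMap.proj_apply,
    smul_eq_mul, one_div, ← Nat.card_eq_fintype_card, key]
  simp

lemma totalMult_character_rotRep (hsimple : ∀ t, Simple (χ t))
    (hdistinct : ∀ s t : Fin N, Nonempty (χ s ≅ χ t) → s = t)
    (hcomplete : ∀ W : FDRep ℂ (DihedralGroup m), Simple W → ∃ t, Nonempty (W ≅ χ t))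
    (a : ZMod m) :
    FDRep.totalMult χ (rotRep a).character = 1 + if a + a = 0 then 1 else 0 := by
  split_ifs with ha
  · have := FDRep.simple_ofMonoidHom (linChar a ha 1 (by norm_num))
    have := FDRep.simple_ofMonoidHom (linChar a ha (-1) (by norm_num))
    have h : (rotRep a).character =
        (FDRep.ofMonoidHom (linChar a ha 1 (by norm_num))).character +
        (FDRep.ofMonoidHom (linChar a ha (-1) (by norm_num))).character :=
      funext (character_rotRep_eq_add a ha)
    rw [h, map_add, totalMult_character_of_simple hsimple hdistinct hcomplete,
      totalMult_character_of_simple hsimple hdistinct hcomplete]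
  · have := simple_rotRep ha
    rw [totalMult_character_of_simple hsimple hdistinct hcomplete, add_zero]

lemma stdAddChar_add_pow (i : ZMod m) (n : ℕ) :
    ((ZMod.stdAddChar i : ℂ) + ZMod.stdAddChar (-i)) ^ n =
      ∑ l ∈ range (n + 1), (n.choose l : ℂ) *
        ZMod.stdAddChar (((l : ZMod m) - ((n - l : ℕ) : ZMod m)) * i) := by
  rw [add_pow]
  refine sum_congr rfl fun l _ ↦ ?_
  rw [← AddChar.map_nsmul_eq_pow, ← AddChar.map_nsmul_eq_pow, ← AddChar.map_add_eq_mul, mul_comm,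
    nsmul_eq_mul, nsmul_eq_mul, mul_neg, ← sub_eq_add_neg, sub_mul]

lemma character_rotRep_pow (a : ZMod m) {n : ℕ} (hn : n ≠ 0) :
    (rotRep a).character ^ n = (1 / 2 : ℂ) • ∑ l ∈ range (n + 1), (n.choose l : ℂ) •
      (rotRep (((l : ZMod m) - ((n - l : ℕ) : ZMod m)) * a)).character := by
  funext g
  rcases g with i | i
  · have h1 := stdAddChar_add_pow (a * i) n
    have h2 := stdAddChar_add_pow (-(a * i)) n
    rw [neg_neg, add_comm] at h2
    simp only [Pi.pow_apply, Pi.smul_apply, Finset.sum_apply, smul_eq_mul, character_rotRep_r, mul_add,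
      sum_add_distrib, mul_assoc, ← mul_neg] at h1 h2 ⊢
    linear_combination (h1 + h2) / 2
  · simp [hn]

lemma bV_rotRep_eq_sum (hsimple : ∀ t, Simple (χ t))
    (hdistinct : ∀ s t : Fin N, Nonempty (χ s ≅ χ t) → s = t)
    (hcomplete : ∀ W : FDRep ℂ (DihedralGroup m), Simple W → ∃ t, Nonempty (W ≅ χ t))
    {a : ZMod m} (ha : IsUnit a) (n : ℕ) :
    bV χ (rotRep a) n = 1 / (2 * m) * (m * 2 ^ n +
      ∑ i : ZMod m, ((ZMod.stdAddChar (2 * i) : ℂ) + ZMod.stdAddChar (-(2 * i))) ^ n) := by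
  have hm : (m : ℂ) ≠ 0 := NeZero.ne _
  rw [FDRep.bV_eq_totalMult]
  rcases eq_or_ne n 0 with rfl | hn
  · have := FDRep.simple_ofMonoidHom (1 : DihedralGroup m →* ℂ)
    have h : (rotRep a).character ^ 0 = (FDRep.ofMonoidHom (1 : DihedralGroup m →* ℂ)).character :=
      funext fun g ↦ by simp [FDRep.character_ofMonoidHom]
    rw [h, totalMult_character_of_simple hsimple hdistinct hcomplete]
    simp
    field_simp
    norm_num
  · have hsum : ∑ i : ZMod m, ((ZMod.stdAddChar (2 * i) : ℂ) + ZMod.stdAddChar (-(2 * i))) ^ n =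
        ∑ l ∈ range (n + 1), (n.choose l : ℂ) * (m * if ((l : ZMod m) - ((n - l : ℕ) : ZMod m)) * a
          + ((l : ZMod m) - ((n - l : ℕ) : ZMod m)) * a = 0 then 1 else 0) := by
      rw [← Equiv.sum_comp ha.unit.mulLeft]
      simp only [Units.mulLeft_apply, IsUnit.unit_spec, stdAddChar_add_pow]
      rw [sum_comm]
      refine sum_congr rfl fun l _ ↦ ?_
      rw [← mul_sum, mul_ite, mul_one, mul_zero, ← sum_stdAddChar_mul]
      congr 2 with i
      ring_nf
    have hchoose : ∑ l ∈ range (n + 1), (n.choose l : ℂ) = 2 ^ n := by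
      exact_mod_cast Nat.sum_range_choose n
    rw [character_rotRep_pow a hn, hsum, ← hchoose, map_smul, map_sum]
    simp only [map_smul, totalMult_character_rotRep hsimple hdistinct hcomplete, smul_eq_mul,
      mul_add, mul_one, sum_add_distrib, mul_left_comm _ (m : ℂ), ← mul_sum]
    field_simp

end TotalMult

lemma stdAddChar_natCast_add_neg (k : ℕ) :
    (ZMod.stdAddChar (k : ZMod m) : ℂ) + ZMod.stdAddChar (-(k : ZMod m)) =
      2 * (Real.cos (2 * Real.pi * k / m) : ℂ) := by
  have h1 := ZMod.stdAddChar_coe (N := m) k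
  have h2 := ZMod.stdAddChar_coe (N := m) (-k)
  push_cast at h1 h2
  rw [h1, h2, Complex.ofReal_cos, Complex.two_cos]
  push_cast
  ring_nf

lemma sum_zmod_eq_sum_range (f : ZMod m → ℂ) : ∑ i, f i = ∑ k ∈ range m, f k := by
  obtain ⟨p, rfl⟩ := Nat.exists_eq_succ_of_ne_zero (NeZero.ne m)
  rw [← Fin.sum_univ_eq_sum_range (fun k ↦ f k)]
  refine Fintype.sum_congr _ _ fun i ↦ ?_
  exact congrArg f (ZMod.natCast_zmod_val (n := p + 1) i).symm

end DihedralGroup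

lemma sum_range_odd_of_symm (p : ℕ) (f : ℕ → ℂ)
    (hf : ∀ k ≤ 2 * p + 1, f (2 * p + 1 - k) = f k) :
    ∑ k ∈ range (2 * p + 1), f k = f 0 + 2 * ∑ k ∈ Icc 1 p, f k := by
  have h1 : ∑ k ∈ Icc 1 p, f k = ∑ k ∈ range p, f (k + 1) := by
    rw [range_eq_Ico, sum_Ico_add' f 0 p 1, zero_add, Ico_add_one_right_eq_Icc]
  have h2 : ∑ k ∈ range p, f (p + k + 1) = ∑ k ∈ range p, f (k + 1) := by
    rw [← sum_range_reflect]
    refine sum_congr rfl fun k hk ↦ ?_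
    rw [mem_range] at hk
    rw [← hf (k + 1) (by omega)]
    congr 1
    omega
  rw [sum_range_succ', two_mul p, sum_range_add, h1, h2]
  ring

lemma sum_range_even_of_symm (p : ℕ) (f : ℕ → ℂ)
    (hf : ∀ k ≤ 2 * p + 2, f (2 * p + 2 - k) = f k) :
    ∑ k ∈ range (2 * p + 2), f k = f 0 + f (p + 1) + 2 * ∑ k ∈ Icc 1 p, f k := by
  have h1 : ∑ k ∈ Icc 1 p, f k = ∑ k ∈ range p, f (k + 1) := by
    rw [range_eq_Ico, sum_Ico_add' f 0 p 1, zero_add, Ico_add_one_right_eq_Icc]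
  have h2 : ∑ k ∈ range p, f (p + 1 + k + 1) = ∑ k ∈ range p, f (k + 1) := by
    rw [← sum_range_reflect]
    refine sum_congr rfl fun k hk ↦ ?_
    rw [mem_range] at hk
    rw [← hf (k + 1) (by omega)]
    congr 1
    omega
  rw [sum_range_succ', show 2 * p + 1 = (p + 1) + p by ring, sum_range_add, sum_range_succ, h1, h2]
  ring

lemma cos_two_pi_mul_sub (M k : ℕ) (hM : M ≠ 0) (hk : k ≤ M) :
    Real.cos (2 * Real.pi * (M - k : ℕ) / M) = Real.cos (2 * Real.pi * k / M) := by
  have hM' : (M : ℝ) ≠ 0 := by exact_mod_cast hM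
  rw [Nat.cast_sub hk, mul_sub, sub_div, mul_div_assoc, div_self hM', mul_one,
    Real.cos_two_pi_sub]

lemma sum_range_cos_pow_odd (p n : ℕ) :
    ∑ k ∈ range (2 * p + 1), (2 * (Real.cos (2 * Real.pi * k / (2 * p + 1 : ℕ)) : ℂ)) ^ n =
      2 ^ n * (1 + 2 * ∑ k ∈ Icc 1 p,
        (Real.cos (2 * Real.pi * k / (2 * p + 1 : ℕ)) : ℂ) ^ n) := by
  rw [sum_range_odd_of_symm p _ fun k hk ↦ by rw [cos_two_pi_mul_sub _ _ (by omega) hk]]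
  simp only [mul_pow, ← mul_sum, Nat.cast_zero, mul_zero, zero_div, Real.cos_zero,
    Complex.ofReal_one, one_pow]
  ring

lemma sum_range_cos_pow_even (p n : ℕ) :
    ∑ k ∈ range (2 * p + 2), (2 * (Real.cos (2 * Real.pi * k / (2 * p + 2 : ℕ)) : ℂ)) ^ n =
      2 ^ n * (1 + (-1) ^ n + 2 * ∑ k ∈ Icc 1 p,
        (Real.cos (2 * Real.pi * k / (2 * p + 2 : ℕ)) : ℂ) ^ n) := by
  have hp : 2 * Real.pi * (p + 1 : ℕ) / (2 * p + 2 : ℕ) = Real.pi := by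
    have : (p : ℝ) + 1 ≠ 0 := by positivity
    push_cast
    field_simp
  rw [sum_range_even_of_symm p _ fun k hk ↦ by rw [cos_two_pi_mul_sub _ _ (by omega) hk], hp]
  simp only [mul_pow, ← mul_sum, Nat.cast_zero, mul_zero, zero_div, Real.cos_zero,
    Complex.ofReal_one, one_pow, Real.cos_pi, Complex.ofReal_neg]
  ring

namespace DihedralGroup

variable {m : ℕ} [NeZero m]

lemma sum_stdAddChar_two_mul_of_odd (hm : Odd m) (n : ℕ) :
    ∑ i : ZMod m, ((ZMod.stdAddChar (2 * i) : ℂ) + ZMod.stdAddChar (-(2 * i))) ^ n =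
      ∑ k ∈ range m, (2 * (Real.cos (2 * Real.pi * k / m) : ℂ)) ^ n := by
  have h2 : IsUnit (2 : ZMod m) := by
    have := (ZMod.isUnit_iff_coprime 2 m).mpr (Nat.coprime_two_left.mpr hm)
    exact_mod_cast this
  have := Equiv.sum_comp h2.unit.mulLeft
    (fun i : ZMod m ↦ ((ZMod.stdAddChar i : ℂ) + ZMod.stdAddChar (-i)) ^ n)
  simp only [Units.mulLeft_apply, IsUnit.unit_spec] at this
  rw [this, sum_zmod_eq_sum_range]
  simp only [stdAddChar_natCast_add_neg]

lemma sum_stdAddChar_two_mul_of_even {h : ℕ} (hm : m = h + h) (n : ℕ) :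
    ∑ i : ZMod m, ((ZMod.stdAddChar (2 * i) : ℂ) + ZMod.stdAddChar (-(2 * i))) ^ n =
      2 * ∑ k ∈ range h, (2 * (Real.cos (2 * Real.pi * k / h) : ℂ)) ^ n := by
  have hh : (h : ℝ) ≠ 0 := by
    have := NeZero.ne m
    exact_mod_cast (by omega : h ≠ 0)
  have h1 (k : ℕ) : (ZMod.stdAddChar (2 * (k : ZMod m)) : ℂ) + ZMod.stdAddChar (-(2 * (k : ZMod m)))
      = 2 * (Real.cos (2 * Real.pi * k / h) : ℂ) := by
    have := stdAddChar_natCast_add_neg (m := m) (2 * k)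
    push_cast [hm] at this ⊢
    rw [this, ← two_mul (h : ℂ), mul_left_comm (2 * (Real.pi : ℂ)),
      mul_div_mul_left _ _ two_ne_zero]
  have h2 (k : ℕ) : Real.cos (2 * Real.pi * (h + k : ℕ) / h) = Real.cos (2 * Real.pi * k / h) := by
    rw [Nat.cast_add, mul_add, add_div, mul_div_assoc, div_self hh, mul_one, add_comm,
      Real.cos_add_two_pi]
  rw [sum_zmod_eq_sum_range]
  simp only [h1]
  rw [hm, sum_range_add]
  simp only [h2]
  ring

end DihedralGroup

theorem stmt_7 (m : ℕ) [NeZero m] (hm : 3 ≤ m) {N : ℕ}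
    (χ : Fin N → FDRep ℂ (DihedralGroup m))
    (hsimple : ∀ t, Simple (χ t))
    (hdistinct : ∀ s t : Fin N, Nonempty (χ s ≅ χ t) → s = t)
    (hcomplete : ∀ W : FDRep ℂ (DihedralGroup m), Simple W → ∃ t, Nonempty (W ≅ χ t))
    (V : FDRep ℂ (DihedralGroup m))
    (hVfaith : Function.Injective V.ρ) (hVirr : Simple V)
    (n : ℕ) :
    (Odd m →
      bV χ V n = ((2 : ℂ) ^ n / (2 * (m : ℂ))) * ((m : ℂ) + 1 +
        2 * ∑ k ∈ Finset.Icc 1 ((m - 1) / 2),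
          ((Real.cos (2 * Real.pi * (k : ℝ) / (m : ℝ)) : ℂ)) ^ n)) ∧
    (Even m → Odd (m / 2) →
      bV χ V n = ((2 : ℂ) ^ n / (2 * (m : ℂ))) * ((m : ℂ) + 2 +
        4 * ∑ k ∈ Finset.Icc 1 ((m - 2) / 4),
          ((Real.cos (4 * Real.pi * (k : ℝ) / (m : ℝ)) : ℂ)) ^ n)) ∧
    (Even m → Even (m / 2) →
      bV χ V n = ((2 : ℂ) ^ n / (2 * (m : ℂ))) * ((m : ℂ) + 2 + 2 * (-1 : ℂ) ^ n +
        4 * ∑ k ∈ Finset.Icc 1 ((m - 2) / 4),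
          ((Real.cos (4 * Real.pi * (k : ℝ) / (m : ℝ)) : ℂ)) ^ n)) := by
  obtain ⟨a, ha, ⟨i⟩⟩ := DihedralGroup.exists_isUnit_iso_rotRep hm V hVfaith
  have hV : bV χ V n = bV χ (DihedralGroup.rotRep a) n := by
    simp only [bV, FDRep.char_iso i]
  have hm0 : (m : ℂ) ≠ 0 := NeZero.ne _
  rw [hV, DihedralGroup.bV_rotRep_eq_sum hsimple hdistinct hcomplete ha]
  refine ⟨fun hodd ↦ ?_, fun heven hodd ↦ ?_, fun heven heven' ↦ ?_⟩
  · rw [DihedralGroup.sum_stdAddChar_two_mul_of_odd hodd]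
    obtain ⟨p, rfl⟩ := hodd
    rw [sum_range_cos_pow_odd, show (2 * p + 1 - 1) / 2 = p by omega]
    field_simp
    ring
  · obtain ⟨p, hp⟩ := hodd
    have hmp : m = (2 * p + 1) + (2 * p + 1) := by
      obtain ⟨h, rfl⟩ := heven
      omega
    have hcos (k : ℕ) : 4 * Real.pi * k / m = 2 * Real.pi * k / (2 * p + 1 : ℕ) := by
      rw [hmp]
      push_cast
      field_simp
      ring
    simp only [hcos]
    rw [DihedralGroup.sum_stdAddChar_two_mul_of_even hmp, sum_range_cos_pow_odd,
      show (m - 2) / 4 = p by omega]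
    field_simp
    ring
  · obtain ⟨p, hp⟩ : ∃ p, m / 2 = 2 * p + 2 := by
      obtain ⟨q, hq⟩ := heven'
      exact ⟨q - 1, by omega⟩
    have hmp : m = (2 * p + 2) + (2 * p + 2) := by
      obtain ⟨h, rfl⟩ := heven
      omega
    have hcos (k : ℕ) : 4 * Real.pi * k / m = 2 * Real.pi * k / (2 * p + 2 : ℕ) := by
      rw [hmp]
      push_cast
      field_simp
      ring
    simp only [hcos]
    rw [DihedralGroup.sum_stdAddChar_two_mul_of_even hmp, sum_range_cos_pow_even,
      show (m - 2) / 4 = p by omega]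
    field_simp
    ring
end

section
/- Let m ≥ 1 and let V be a finite-dimensional complex representation of the symmetric group S_m (permutations of {1,…,m}) with character χ. Then for every n ≥ 0: b_V(n) = (1/m!) · Σ_{σ ∈ S_m} r_2(σ) · χ(σ)^n, where r_2(σ) := #{ τ ∈ S_m : τ² = σ } is the number of square roots of σ in S_m. -/
open CategoryTheory Finset

namespace Equiv.Perm

/-- Every permutation is conjugate to its inverse by a permutation fixing a prescribed point. -/
theorem exists_conj_eq_inv_of_apply_eq {α : Type*} (g : Perm α) (x : α) :
    ∃ h : Perm α, h x = x ∧ h * g * h⁻¹ = g⁻¹ := by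
  classical
  obtain ⟨r, hr, hrc, hrx⟩ : ∃ r : α → α, (∀ y, g.SameCycle (r y) y) ∧
      (∀ y z, g.SameCycle y z → r y = r z) ∧ r x = x := by
    let s := SameCycle.setoid g
    refine ⟨fun y ↦ if g.SameCycle x y then x else (Quotient.mk s y).out, fun y ↦ ?_,
      fun y z hyz ↦ ?_, if_pos (SameCycle.refl g x)⟩
    · dsimp only
      split_ifs with h
      · exact h
      · exact Quotient.mk_out (s := s) y
    · have h : g.SameCycle x y ↔ g.SameCycle x z :=
        ⟨fun h ↦ h.trans hyz, fun h ↦ h.trans hyz.symm⟩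
      have h' : Quotient.mk s y = Quotient.mk s z := Quotient.sound hyz
      simp only [h, h']
  choose k hk using hr
  have key (y : α) (i : ℤ) : (g ^ (-k ((g ^ i) (r y)))) (r y) = (g ^ (-i)) (r y) := by
    set z := (g ^ i) (r y) with hz
    have hrz : r z = r y := by
      refine hrc _ _ ?_
      exact (SameCycle.symm ⟨i, rfl⟩).trans ⟨k y, hk y⟩
    have h1 := hk z
    rw [hrz] at h1
    have h2 : (g ^ (-i)) ((g ^ (-k z)) ((g ^ k z) (r y))) =
        (g ^ (-i)) ((g ^ (-k z)) ((g ^ i) (r y))) := by rw [h1]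
    simp only [← mul_apply, ← zpow_add] at h2 ⊢
    have e1 : -i + (-k z + k z) = -i := by ring
    have e2 : -i + (-k z + i) = -k z := by ring
    rw [e1, e2] at h2
    exact h2.symm
  let f : α → α := fun y ↦ (g ^ (-k y)) (r y)
  have hr' (y : α) (i : ℤ) : r ((g ^ i) (r y)) = r y :=
    hrc _ _ ((SameCycle.symm ⟨i, rfl⟩).trans ⟨k y, hk y⟩)
  have hf (y : α) (i : ℤ) : f ((g ^ i) (r y)) = (g ^ (-i)) (r y) := by
    simp only [f, hr']
    exact key y i
  have hff : Function.Involutive f := fun y ↦ by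
    change f ((g ^ (-k y)) (r y)) = y
    rw [hf, neg_neg, hk]
  have hfg (y : α) : f (g y) = g⁻¹ (f y) := by
    have h : g y = (g ^ (1 + k y)) (r y) := by rw [zpow_add, mul_apply, hk, zpow_one]
    rw [h, hf, neg_add, zpow_add, mul_apply, zpow_neg_one]
  refine ⟨hff.toPerm, ?_, ?_⟩
  · change f x = x
    have h := hf x 0
    simpa [hrx] using h
  · rw [mul_inv_eq_iff_eq_mul]
    ext y
    exact hfg y

end Equiv.Perm

namespace Representation

open Module LinearMap

section Decomposition

universe u

variable {k G : Type*} [Field k] [Group G] [Finite G] [NeZero (Nat.card G : k)]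

theorem exists_equiv_prod_of_not_isIrreducible {V : Type*} [AddCommGroup V] [Module k V]
    [FiniteDimensional k V] [Nontrivial V] (ρ : Representation k G V) (hρ : ¬ ρ.IsIrreducible) :
    ∃ σ τ : Subrepresentation ρ, finrank k σ.toSubmodule < finrank k V ∧
      finrank k τ.toSubmodule < finrank k V ∧
      Nonempty ((σ.toRepresentation.prod τ.toRepresentation).Equiv ρ) := by
  have hbt : (⊥ : Subrepresentation ρ) ≠ ⊤ := fun h ↦
    bot_ne_top (α := Submodule k V) (congrArg Subrepresentation.toSubmodule h)
  have : Nontrivial (Subrepresentation ρ) := ⟨_, _, hbt⟩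
  obtain ⟨σ, hσ⟩ : ∃ σ : Subrepresentation ρ, ¬ (σ = ⊥ ∨ σ = ⊤) := by
    by_contra! h
    exact hρ ⟨h⟩
  rw [not_or] at hσ
  obtain ⟨τ, hστ⟩ := exists_isCompl σ
  have hc : IsCompl σ.toSubmodule τ.toSubmodule := by
    refine IsCompl.of_eq ?_ ?_
    · exact congrArg Subrepresentation.toSubmodule hστ.inf_eq_bot
    · exact congrArg Subrepresentation.toSubmodule hστ.sup_eq_top
  have hlt (θ : Subrepresentation ρ) (h : θ ≠ ⊤) : finrank k θ.toSubmodule < finrank k V :=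
    Submodule.finrank_lt fun h' ↦ h (Subrepresentation.toSubmodule_injective h')
  refine ⟨σ, τ, hlt σ hσ.2, hlt τ ?_, ⟨.mk (Submodule.prodEquivOfIsCompl _ _ hc) fun g ↦ ?_⟩⟩
  · rintro rfl
    exact hσ.1 (by simpa using hστ.inf_eq_bot)
  · ext v <;> simp [Representation.prod, Subrepresentation.toRepresentation]

/-- Maschke's theorem as an induction principle: a property of finite-dimensional representations
that holds for zero and irreducible ones and passes to direct sums holds for all. -/
theorem induction_on_prod
    (P : ∀ (V : Type u) [AddCommGroup V] [Module k V] [FiniteDimensional k V],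
      Representation k G V → Prop)
    (zero : ∀ (V : Type u) [AddCommGroup V] [Module k V] [FiniteDimensional k V] [Subsingleton V]
      (ρ : Representation k G V), P V ρ)
    (irreducible : ∀ (V : Type u) [AddCommGroup V] [Module k V] [FiniteDimensional k V]
      (ρ : Representation k G V), ρ.IsIrreducible → P V ρ)
    (prod : ∀ (U V W : Type u) [AddCommGroup U] [Module k U] [FiniteDimensional k U]
      [AddCommGroup V] [Module k V] [FiniteDimensional k V]
      [AddCommGroup W] [Module k W] [FiniteDimensional k W]
      (σ : Representation k G U) (τ : Representation k G V) (ρ : Representation k G W),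
      (σ.prod τ).Equiv ρ → P U σ → P V τ → P W ρ)
    (V : Type u) [AddCommGroup V] [Module k V] [FiniteDimensional k V]
    (ρ : Representation k G V) : P V ρ := by
  induction hn : finrank k V using Nat.strong_induction_on generalizing V with
  | _ n ih =>
    subst hn
    cases subsingleton_or_nontrivial V
    · exact zero V ρ
    by_cases hρ : ρ.IsIrreducible
    · exact irreducible V ρ hρ
    obtain ⟨σ, τ, hσ, hτ, ⟨e⟩⟩ := exists_equiv_prod_of_not_isIrreducible ρ hρ
    exact prod _ _ _ _ _ _ e (ih _ hσ _ _ rfl) (ih _ hτ _ _ rfl)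

theorem exists_isIrreducible_retract {V : Type u} [AddCommGroup V] [Module k V]
    [FiniteDimensional k V] [Nontrivial V] (ρ : Representation k G V) :
    ∃ (W : Type u) (_ : AddCommGroup W) (_ : Module k W) (_ : FiniteDimensional k W)
      (σ : Representation k G W) (i : IntertwiningMap σ ρ) (p : IntertwiningMap ρ σ),
      σ.IsIrreducible ∧ ∀ w, p (i w) = w := by
  suffices h : ∀ (V : Type u) [AddCommGroup V] [Module k V] [FiniteDimensional k V]
      (ρ : Representation k G V), Nontrivial V →
      ∃ (W : Type u) (_ : AddCommGroup W) (_ : Module k W) (_ : FiniteDimensional k W)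
      (σ : Representation k G W) (i : IntertwiningMap σ ρ) (p : IntertwiningMap ρ σ),
      σ.IsIrreducible ∧ ∀ w, p (i w) = w from h V ρ inferInstance
  clear! V
  intro V _ _ _ ρ
  refine induction_on_prod (k := k) (G := G) (fun V _ _ _ ρ ↦ Nontrivial V →
      ∃ (W : Type u) (_ : AddCommGroup W) (_ : Module k W) (_ : FiniteDimensional k W)
      (σ : Representation k G W) (i : IntertwiningMap σ ρ) (p : IntertwiningMap ρ σ),
      σ.IsIrreducible ∧ ∀ w, p (i w) = w) ?_ ?_ ?_ V ρ
  · intro V _ _ _ _ ρ h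
    exact (not_subsingleton V inferInstance).elim
  · intro V _ _ _ ρ hρ _
    exact ⟨V, _, _, ‹_›, ρ, .id ρ, .id ρ, hρ, fun _ ↦ rfl⟩
  · intro U V W _ _ _ _ _ _ _ _ _ σ τ ρ e hU hV hW
    have : Nontrivial (U × V) := e.toLinearEquiv.toEquiv.nontrivial
    by_cases h : Nontrivial U
    · obtain ⟨X, _, _, _, θ, i, p, hθ, hpi⟩ := hU h
      refine ⟨X, _, _, ‹_›, θ, e.toIntertwiningMap.comp ((IntertwiningMap.inl k σ τ).comp i),
        p.comp ((IntertwiningMap.fst k σ τ).comp e.symm.toIntertwiningMap), hθ, fun w ↦ ?_⟩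
      simpa [IntertwiningMap.inl, IntertwiningMap.prod] using hpi w
    · have : Nontrivial V := by
        by_contra h'
        rw [not_nontrivial_iff_subsingleton] at h h'
        exact not_subsingleton (U × V) inferInstance
      obtain ⟨X, _, _, _, θ, i, p, hθ, hpi⟩ := hV this
      refine ⟨X, _, _, ‹_›, θ, e.toIntertwiningMap.comp ((IntertwiningMap.inr k σ τ).comp i),
        p.comp ((IntertwiningMap.snd k σ τ).comp e.symm.toIntertwiningMap), hθ, fun w ↦ ?_⟩
      simpa [IntertwiningMap.inr, IntertwiningMap.prod] using hpi w

end Decomposition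

theorem character_prod {k G V W : Type*} [Field k] [Monoid G] [AddCommGroup V] [Module k V]
    [FiniteDimensional k V] [AddCommGroup W] [Module k W] [FiniteDimensional k W]
    (σ : Representation k G V) (τ : Representation k G W) :
    (σ.prod τ).character = σ.character + τ.character := by
  ext g
  exact trace_prodMap' (σ g) (τ g)

theorem trace_eq_sum_coord {k V ι : Type*} [Field k] [AddCommGroup V] [Module k V]
    [Fintype ι] (b : Basis ι k V) (A : Module.End k V) :
    trace k V A = ∑ i, b.coord i (A (b i)) := by
  classical
  simp [trace_eq_matrix_trace k b, Matrix.trace, toMatrix_apply]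

theorem character_eq_sum {k G V ι : Type*} [Field k] [Monoid G] [AddCommGroup V] [Module k V]
    [Fintype ι] (b : Basis ι k V) (ρ : Representation k G V) (g : G) :
    ρ.character g = ∑ i, b.coord i (ρ g (b i)) :=
  trace_eq_sum_coord b (ρ g)

section Schur

variable {k G V : Type*} [Field k] [IsAlgClosed k] [Group G] [Fintype G] [AddCommGroup V]
  [Module k V] [FiniteDimensional k V] (ρ : Representation k G V)

/-- Schur orthogonality of matrix coefficients, in operator form. -/
theorem finrank_smul_sum_smul [ρ.IsIrreducible] (f : Dual k V) (x y : V) :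
    (finrank k V : k) • ∑ g, f (ρ g⁻¹ y) • ρ g x = ((Nat.card G : k) * f x) • y := by
  let T : V →ₗ[k] V := ∑ g, (f ∘ₗ ρ g⁻¹).smulRight (ρ g x)
  have hT (v : V) : T v = ∑ g, f (ρ g⁻¹ v) • ρ g x := by simp [T]
  have hint (h : G) (v : V) : T (ρ h v) = ρ h (T v) := by
    rw [hT, hT, map_sum, ← Equiv.sum_comp (Equiv.mulLeft h)]
    refine Finset.sum_congr rfl fun g _ ↦ ?_
    simp only [Equiv.coe_mulLeft, map_smul, ← Module.End.mul_apply, ← map_mul]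
    congr 4
    group
  obtain ⟨c, hc⟩ := (IsIrreducible.algebraMap_intertwiningMap_bijective_of_isAlgClosed
    (ρ := ρ)).2 ⟨T, fun g ↦ by ext v; exact hint g v⟩
  have hTc (v : V) : T v = c • v := (congrArg (fun F : IntertwiningMap ρ ρ ↦ F v) hc).symm
  have htr : trace k V T = (Nat.card G : k) * f x := by
    simp only [T, map_sum]
    rw [Finset.sum_congr rfl (g := fun _ ↦ f x)]
    · simp
    · intro g _
      rw [trace_smulRight]
      simp
  have htr' : trace k V T = c * finrank k V := by
    rw [show T = c • 1 from LinearMap.ext hTc]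
    simp
  rw [← hT, hTc, ← htr, htr', smul_smul, mul_comm]

/-- Fourier inversion for an irreducible representation. -/
theorem finrank_smul_sum_trace_smul [ρ.IsIrreducible] (A : Module.End k V) (x : V) :
    (finrank k V : k) • ∑ g, trace k V (A * ρ g⁻¹) • ρ g x = (Nat.card G : k) • A x := by
  let b := finBasis k V
  calc (finrank k V : k) • ∑ g, trace k V (A * ρ g⁻¹) • ρ g x
      = ∑ i, (finrank k V : k) • ∑ g, (b.coord i ∘ₗ A) (ρ g⁻¹ (b i)) • ρ g x := by
        simp_rw [trace_eq_sum_coord b, Finset.sum_smul]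
        rw [Finset.sum_comm, Finset.smul_sum]
        rfl
    _ = (Nat.card G : k) • ∑ i, b.repr (A x) i • b i := by
        simp_rw [finrank_smul_sum_smul, Finset.smul_sum, smul_smul]
        rfl
    _ = (Nat.card G : k) • A x := by rw [b.sum_repr]

/-- If every element of `G` is conjugate to its inverse under the subgroup `ι(H)`, then every
endomorphism commuting with `H` is self-adjoint for all `G`-invariant bilinear forms. -/
theorem isSelfAdjoint_of_commute [CharZero k] [ρ.IsIrreducible] {H : Type*} [Group H] (ι : H →* G)
    (hι : ∀ g : G, ∃ h : H, ι h * g * (ι h)⁻¹ = g⁻¹) {B : LinearMap.BilinForm k V}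
    (hB : ∀ g v w, B (ρ g v) (ρ g w) = B v w) {A : Module.End k V}
    (hA : ∀ h, Commute A (ρ (ι h))) (v w : V) : B (A v) w = B v (A w) := by
  have hB' (g : G) (v w : V) : B (ρ g v) w = B v (ρ g⁻¹ w) := by
    rw [← hB g⁻¹ (ρ g v), inv_self_apply]
  have htr (g : G) : trace k V (A * ρ g⁻¹) = trace k V (A * ρ g) := by
    obtain ⟨h, hh⟩ := hι g
    rw [← hh, map_mul ρ, map_mul ρ, ← mul_assoc, ← mul_assoc, (hA h).eq, trace_mul_comm,
      ← mul_assoc, ← mul_assoc, ← map_mul ρ, inv_mul_cancel, map_one, one_mul]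
  have hG : (Nat.card G : k) ≠ 0 := Nat.cast_ne_zero.2 Nat.card_pos.ne'
  apply mul_left_cancel₀ hG
  calc (Nat.card G : k) * B (A v) w = B ((Nat.card G : k) • A v) w := by simp
    _ = (finrank k V : k) * ∑ g, trace k V (A * ρ g⁻¹) * B (ρ g v) w := by
      rw [← finrank_smul_sum_trace_smul ρ]
      simp [LinearMap.sum_apply]
    _ = (finrank k V : k) * ∑ g, trace k V (A * ρ g⁻¹) * B v (ρ g w) := by
      rw [← Equiv.sum_comp (Equiv.inv G)]
      simp only [Equiv.inv_apply, hB', inv_inv, htr]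
    _ = B v ((Nat.card G : k) • A w) := by
      rw [← finrank_smul_sum_trace_smul ρ]
      simp
    _ = (Nat.card G : k) * B v (A w) := by simp

end Schur

theorem nondegenerate_of_ne_zero {k G V : Type*} [Field k] [Group G] [AddCommGroup V]
    [Module k V] {ρ : Representation k G V} [ρ.IsIrreducible] {B : LinearMap.BilinForm k V}
    (hB : ∀ g v w, B (ρ g v) (ρ g w) = B v w) (h0 : B ≠ 0) {v : V} (hv : ∀ w, B v w = 0) :
    v = 0 := by
  let K : Subrepresentation ρ := ⟨LinearMap.ker B, fun g v hv ↦ by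
    ext w
    rw [← ρ.self_inv_apply g w, hB]
    simp [LinearMap.mem_ker.1 hv]⟩
  rcases eq_bot_or_eq_top K with h | h
  · have : v ∈ K.toSubmodule := LinearMap.mem_ker.2 (LinearMap.ext hv)
    rw [h] at this
    exact (Submodule.mem_bot k).1 this
  · exact (h0 (LinearMap.ker_eq_top.1 (congrArg Subrepresentation.toSubmodule h))).elim

section FrobeniusSchur

variable {k G : Type*} [Field k] [IsAlgClosed k] [CharZero k] [Group G] [Fintype G]
  {V : Type*} [AddCommGroup V] [Module k V] [FiniteDimensional k V] (ρ : Representation k G V)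

theorem sum_character_mul_character_inv [ρ.IsIrreducible] :
    ∑ g, ρ.character g * ρ.character g⁻¹ = Nat.card G := by
  have hG : (Nat.card G : k) ≠ 0 := Nat.cast_ne_zero.2 Nat.card_pos.ne'
  have := invertibleOfNonzero hG
  have h := char_orthonormal ρ ρ
  rw [if_pos ⟨.refl ρ⟩, inv_mul_eq_one₀ hG] at h
  exact h.symm

theorem exists_invariant_bilinForm_ne_zero [ρ.IsIrreducible]
    (hreal : ∀ g, ρ.character g⁻¹ = ρ.character g) :
    ∃ B : LinearMap.BilinForm k V, (∀ g v w, B (ρ g v) (ρ g w) = B v w) ∧ B ≠ 0 := by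
  by_contra! H
  let b := finBasis k V
  let B (f f' : Dual k V) : LinearMap.BilinForm k V :=
    ∑ g, (LinearMap.mul k k).compl₁₂ (f ∘ₗ ρ g) (f' ∘ₗ ρ g)
  have hB (f f' : Dual k V) (v w : V) : B f f' v w = ∑ g, f (ρ g v) * f' (ρ g w) := by
    simp [B, LinearMap.sum_apply]
  have hB0 (f f' : Dual k V) : B f f' = 0 := by
    refine H _ fun g v w ↦ ?_
    rw [hB, hB, ← Equiv.sum_comp (Equiv.mulRight g) fun x ↦ f (ρ x v) * f' (ρ x w)]
    simp
  have hsum : ∑ g, ρ.character g * ρ.character g⁻¹ = 0 := by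
    simp_rw [hreal, character_eq_sum b, Finset.sum_mul_sum]
    rw [Finset.sum_comm]
    refine Finset.sum_eq_zero fun i _ ↦ ?_
    rw [Finset.sum_comm]
    refine Finset.sum_eq_zero fun j _ ↦ ?_
    rw [← hB, hB0]
    rfl
  rw [sum_character_mul_character_inv] at hsum
  exact Nat.cast_ne_zero.2 Nat.card_pos.ne' hsum

/-- An irreducible representation with a nonzero symmetric invariant bilinear form has
Frobenius–Schur indicator `1`. -/
theorem sum_character_mul_self_of_isSymm [ρ.IsIrreducible] {B : LinearMap.BilinForm k V}
    (hB : ∀ g v w, B (ρ g v) (ρ g w) = B v w) (hsymm : ∀ v w, B v w = B w v) (h0 : B ≠ 0) :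
    ∑ g, ρ.character (g * g) = Nat.card G := by
  classical
  have hnd : B.Nondegenerate :=
    ⟨fun v hv ↦ nondegenerate_of_ne_zero hB h0 hv,
      fun v hv ↦ nondegenerate_of_ne_zero hB h0 fun w ↦ (hsymm v w).trans (hv w)⟩
  let b := finBasis k V
  let b' := B.dualBasis hnd b
  have hcoord (v : V) (i) : b.coord i v = B v (b' i) := by
    conv_rhs => rw [← b.sum_repr v]
    simp only [map_sum, map_smul, LinearMap.sum_apply, LinearMap.smul_apply, smul_eq_mul, b',
      LinearMap.BilinForm.apply_dualBasis_right hnd ⟨hsymm⟩]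
    simp
  have hschur (u x y : V) : (finrank k V : k) • ∑ g, B (ρ g u) y • ρ g x =
      ((Nat.card G : k) * B u x) • y := by
    rw [← finrank_smul_sum_smul ρ (B u) x y]
    have h (g : G) : B (ρ g u) y = B u (ρ g⁻¹ y) := by rw [← hB g u, self_inv_apply]
    simp_rw [h]
  have hd : (finrank k V : k) ≠ 0 := by
    have : Nontrivial V := by
      by_contra h
      rw [not_nontrivial_iff_subsingleton] at h
      exact h0 (LinearMap.ext fun v ↦ by simp [Subsingleton.elim v 0])
    exact Nat.cast_ne_zero.2 finrank_pos.ne'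
  apply mul_left_cancel₀ hd
  have hexp (g : G) : ρ.character (g * g) =
      ∑ i, ∑ j, B (ρ g (b i)) (b' j) * B (ρ g (b j)) (b' i) := by
    rw [character_eq_sum b]
    refine Finset.sum_congr rfl fun i _ ↦ ?_
    rw [hcoord, map_mul, Module.End.mul_apply]
    conv_lhs => rw [← b.sum_repr (ρ g (b i))]
    simp only [map_sum, map_smul, LinearMap.sum_apply, LinearMap.smul_apply, smul_eq_mul]
    refine Finset.sum_congr rfl fun j _ ↦ ?_
    rw [← hcoord (ρ g (b i)), Basis.coord_apply]
  calc (finrank k V : k) * ∑ g, ρ.character (g * g)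
      = ∑ i, ∑ j, B ((finrank k V : k) • ∑ g, B (ρ g (b i)) (b' j) • ρ g (b j)) (b' i) := by
        simp_rw [hexp, Finset.mul_sum, map_smul, map_sum, LinearMap.smul_apply,
          LinearMap.sum_apply, map_smul, LinearMap.smul_apply, smul_eq_mul, Finset.mul_sum]
        rw [Finset.sum_comm]
        refine Finset.sum_congr rfl fun i _ ↦ ?_
        rw [Finset.sum_comm]
    _ = (Nat.card G : k) * ∑ i, B (b i) (∑ j, b.repr (b' i) j • b j) := by
        simp_rw [hschur, Finset.mul_sum, map_sum, Finset.mul_sum, map_smul, LinearMap.smul_apply,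
          smul_eq_mul, ← Basis.coord_apply, hcoord, mul_assoc]
        refine Finset.sum_congr rfl fun i _ ↦ Finset.sum_congr rfl fun j _ ↦ ?_
        rw [hsymm (b' j) (b' i)]
        ring
    _ = (finrank k V : k) * Nat.card G := by
        simp_rw [b.sum_repr, ← hcoord]
        simp [mul_comm]

end FrobeniusSchur

section RealRepresentations

/-- Every invariant bilinear form on an irreducible complex representation of `G` is symmetric. -/
def InvariantFormsSymmetric (G : Type) [Group G] : Prop :=
  ∀ (V : Type) [AddCommGroup V] [Module ℂ V] [FiniteDimensional ℂ V] (ρ : Representation ℂ G V),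
    ρ.IsIrreducible → ∀ B : LinearMap.BilinForm ℂ V, (∀ g v w, B (ρ g v) (ρ g w) = B v w) →
      ∀ v w, B v w = B w v

theorem InvariantFormsSymmetric.of_subsingleton {G : Type} [Group G] [Subsingleton G] :
    InvariantFormsSymmetric G := by
  intro V _ _ _ ρ hρ B _ v w
  have : IsMulCommutative G := ⟨⟨fun _ _ ↦ Subsingleton.elim _ _⟩⟩
  obtain ⟨u, -, hu⟩ := finrank_eq_one_iff'.1 (IsIrreducible.finrank_eq_one_of_isMulCommutative ρ)
  obtain ⟨a, rfl⟩ := hu v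
  obtain ⟨c, rfl⟩ := hu w
  simp only [map_smul, LinearMap.smul_apply, smul_eq_mul]
  ring

theorem InvariantFormsSymmetric.of_hom {G H : Type} [Group G] [Finite G] [Group H] [Finite H]
    (hH : InvariantFormsSymmetric H) (ι : H →* G)
    (hι : ∀ g : G, ∃ h : H, ι h * g * (ι h)⁻¹ = g⁻¹) : InvariantFormsSymmetric G := by
  intro V _ _ _ ρ hρ B hB
  have := Fintype.ofFinite G
  let C := B - B.flip
  have hCB (v w : V) : C v w = B v w - B w v := rfl
  suffices hC : C = 0 by
    intro v w
    rw [← sub_eq_zero, ← hCB, hC]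
    rfl
  have hCinv (g : G) (v w : V) : C (ρ g v) (ρ g w) = C v w := by simp only [hCB, hB]
  by_contra hC
  have : Nontrivial V := by
    by_contra h
    rw [not_nontrivial_iff_subsingleton] at h
    exact hC (LinearMap.ext fun v ↦ by simp [Subsingleton.elim v 0])
  obtain ⟨W, _, _, _, σ, i, p, hσ, hpi⟩ :=
    exists_isIrreducible_retract (ρ.comp ι : Representation ℂ H V)
  have hi (h : H) (w : W) : i (σ h w) = ρ (ι h) (i w) :=
    IntertwiningMap.isIntertwining σ (ρ.comp ι) i h w
  have hp (h : H) (v : V) : p (ρ (ι h) v) = σ h (p v) :=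
    IntertwiningMap.isIntertwining (ρ.comp ι) σ p h v
  have hadj (v w : V) : C (i (p v)) w = C v (i (p w)) :=
    isSelfAdjoint_of_commute ρ ι hι hCinv (A := i.toLinearMap ∘ₗ p.toLinearMap)
      (fun h ↦ LinearMap.ext fun v ↦ by
        change i (p (ρ (ι h) v)) = ρ (ι h) (i (p v))
        rw [hp, hi]) v w
  have hWW (w w' : W) : C (i w) (i w') = 0 := by
    have h := hH W σ hσ (C.compl₁₂ i.toLinearMap i.toLinearMap) (fun h w w' ↦ by
      change C (i (σ h w)) (i (σ h w')) = C (i w) (i w')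
      rw [hi, hi, hCinv]) w w'
    change C (i w) (i w') = C (i w') (i w) at h
    rw [hCB, hCB] at h
    rw [hCB]
    linear_combination h / 2
  have hzero (w : W) : w = 0 := by
    rw [← hpi w, nondegenerate_of_ne_zero hCinv hC (v := i w), map_zero]
    intro v
    rw [← hpi w, hadj, hWW]
  have : Subsingleton W := ⟨fun v w ↦ (hzero v).trans (hzero w).symm⟩
  have : Subsingleton (Subrepresentation σ) :=
    Subrepresentation.toSubmodule_injective.subsingleton
  exact not_subsingleton (Subrepresentation σ) this

theorem invariantFormsSymmetric_perm (α : Type) [Finite α] :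
    InvariantFormsSymmetric (Equiv.Perm α) := by
  classical
  induction hn : Nat.card α generalizing α with
  | zero =>
    have : IsEmpty α := (Nat.card_eq_zero.1 hn).resolve_right (not_infinite_iff_finite.2 ‹_›)
    exact .of_subsingleton
  | succ n ih =>
    have : Nonempty α := (Nat.card_pos_iff.1 (hn ▸ n.succ_pos)).1
    let x := Classical.arbitrary α
    refine .of_hom (ih {y // y ≠ x} ?_) Equiv.Perm.ofSubtype fun g ↦ ?_
    · have := Fintype.ofFinite α
      rw [Nat.card_eq_fintype_card] at hn ⊢
      simp [hn]
    · obtain ⟨h, hx, hg⟩ := g.exists_conj_eq_inv_of_apply_eq x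
      refine ⟨h.subtypePerm fun y ↦ ?_, ?_⟩
      · rw [not_iff_not, ← h.injective.eq_iff (a := y), hx]
      · rwa [Equiv.Perm.ofSubtype_subtypePerm]
        rintro y hy rfl
        exact hy hx

theorem character_perm_inv {α k V : Type*} [Field k] [AddCommGroup V] [Module k V]
    [FiniteDimensional k V] [Nonempty α] (ρ : Representation k (Equiv.Perm α) V)
    (g : Equiv.Perm α) : ρ.character g⁻¹ = ρ.character g := by
  obtain ⟨h, -, hh⟩ := g.exists_conj_eq_inv_of_apply_eq (Classical.arbitrary α)
  rw [← hh, char_conj]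

/-- Irreducible representations of the symmetric group have Frobenius–Schur indicator `1`. -/
theorem sum_character_perm_mul_self {α V : Type} [Fintype α] [DecidableEq α] [Nonempty α]
    [AddCommGroup V] [Module ℂ V] [FiniteDimensional ℂ V]
    (ρ : Representation ℂ (Equiv.Perm α) V) [hρ : ρ.IsIrreducible] :
    ∑ g, ρ.character (g * g) = Nat.card (Equiv.Perm α) := by
  obtain ⟨B, hB, h0⟩ := exists_invariant_bilinForm_ne_zero ρ (character_perm_inv ρ)
  exact sum_character_mul_self_of_isSymm ρ hB (invariantFormsSymmetric_perm α V ρ hρ B hB) h0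

end RealRepresentations

theorem character_inv_eq_conj {G : Type*} [Group G] [Finite G] {V : Type*} [AddCommGroup V]
    [Module ℂ V] [FiniteDimensional ℂ V] (ρ : Representation ℂ G V) (g : G) :
    ρ.character g⁻¹ = starRingEnd ℂ (ρ.character g) := by
  let C := Subgroup.zpowers g
  let g₀ : C := ⟨g, Subgroup.mem_zpowers g⟩
  let ρC : Representation ℂ C V := ρ.comp C.subtype
  change ρC.character g₀⁻¹ = starRingEnd ℂ (ρC.character g₀)
  refine induction_on_prod (k := ℂ) (G := C)
    (fun V _ _ _ σ ↦ σ.character g₀⁻¹ = starRingEnd ℂ (σ.character g₀)) ?_ ?_ ?_ V ρC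
  · intro V _ _ _ _ σ
    simp [character, Subsingleton.elim (σ _) 0]
  · intro V _ _ _ σ hσ
    have h1 : finrank ℂ V = 1 := IsIrreducible.finrank_eq_one_of_isMulCommutative σ
    obtain ⟨c, hc⟩ : ∃ c : ℂ, σ g₀ = c • 1 := by
      obtain ⟨c, hc, -⟩ := LinearMap.existsUnique_eq_smul_id_of_finrank_eq_one h1 (σ g₀)
      exact ⟨c, hc⟩
    have hpow : c ^ orderOf g₀ = 1 := by
      have h : (c ^ orderOf g₀) • (1 : Module.End ℂ V) = 1 := by
        rw [← one_pow (orderOf g₀), ← smul_pow, ← hc, ← map_pow, pow_orderOf_eq_one, map_one,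
          one_pow]
      have := congrArg (LinearMap.trace ℂ V) h
      simpa [h1] using this
    have hc0 : c ≠ 0 := by
      rintro rfl
      simp [(orderOf_pos g₀).ne'] at hpow
    have hinv : σ g₀⁻¹ = c⁻¹ • 1 := by
      have h : σ g₀ * σ g₀⁻¹ = 1 := by rw [← map_mul, mul_inv_cancel, map_one]
      rw [← h, hc, smul_mul_assoc, one_mul, smul_smul, inv_mul_cancel₀ hc0, one_smul]
    have hnorm := Complex.norm_eq_one_of_pow_eq_one hpow (orderOf_pos g₀).ne'
    simp [character, hc, hinv, h1, Complex.inv_eq_conj hnorm]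
  · intro U V W _ _ _ _ _ _ _ _ _ σ τ ρ e hU hV
    rw [← char_iso e, character_prod, Pi.add_apply, Pi.add_apply, hU, hV, map_add]

end Representation

universe u

namespace FDRep

theorem simple_of_isIrreducible {k G V : Type u} [Field k] [IsAlgClosed k] [CharZero k]
    [Group G] [Finite G] [AddCommGroup V] [Module k V] [FiniteDimensional k V]
    (ρ : Representation k G V) [ρ.IsIrreducible] : Simple (FDRep.of ρ) := by
  have := Fintype.ofFinite G
  rw [simple_iff_char_is_norm_one]
  exact Representation.sum_character_mul_character_inv ρ

/-- The characters of the tensor powers of a representation. -/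
theorem exists_character_eq_pow {k G : Type*} [Field k] [Monoid G] (V : FDRep k G) (n : ℕ) :
    ∃ W : FDRep k G, ∀ g, W.character g = V.character g ^ n := by
  induction n with
  | zero =>
    refine ⟨FDRep.of (Representation.trivial k G k), fun g ↦ ?_⟩
    rw [pow_zero]
    change LinearMap.trace k k LinearMap.id = 1
    simp
  | succ n ih =>
    obtain ⟨W, hW⟩ := ih
    exact ⟨MonoidalCategoryStruct.tensorObj W V, fun g ↦ by
      rw [char_tensor, Pi.mul_apply, hW, pow_succ]⟩

end FDRep

theorem Representation.sum_sum_character_mul_conj_eq {α : Type} [Fintype α] [DecidableEq α]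
    [Nonempty α] {N : ℕ} (χ : Fin N → FDRep ℂ (Equiv.Perm α)) (hsimple : ∀ t, Simple (χ t))
    (hdistinct : ∀ s t : Fin N, Nonempty (χ s ≅ χ t) → s = t)
    (hcomplete : ∀ W : FDRep ℂ (Equiv.Perm α), Simple W → ∃ t, Nonempty (W ≅ χ t))
    {V : Type} [AddCommGroup V] [Module ℂ V] [FiniteDimensional ℂ V]
    (ρ : Representation ℂ (Equiv.Perm α) V) :
    ∑ t, ∑ g, ρ.character g * starRingEnd ℂ ((χ t).character g) =
      ∑ g, ρ.character (g * g) := by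
  refine induction_on_prod (k := ℂ) (G := Equiv.Perm α)
    (fun V _ _ _ ρ ↦ ∑ t, ∑ g, ρ.character g * starRingEnd ℂ ((χ t).character g) =
      ∑ g, ρ.character (g * g)) ?_ ?_ ?_ V ρ
  · intro V _ _ _ _ σ
    simp [character, Subsingleton.elim (σ _) 0]
  · intro V _ _ _ σ hσ
    have hG : (Nat.card (Equiv.Perm α) : ℂ) ≠ 0 := Nat.cast_ne_zero.2 Nat.card_pos.ne'
    have := invertibleOfNonzero hG
    obtain ⟨t, ⟨e⟩⟩ := hcomplete _ (FDRep.simple_of_isIrreducible σ)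
    have hchar : σ.character = (χ t).character := by
      rw [← FDRep.char_iso e]
      rfl
    rw [sum_character_perm_mul_self, Finset.sum_eq_single t]
    · have h := FDRep.char_orthonormal (χ t) (χ t)
      rw [if_pos ⟨Iso.refl _⟩, inv_mul_eq_one₀ hG] at h
      rw [h, hchar]
      exact Finset.sum_congr rfl fun g _ ↦
        congrArg _ (character_inv_eq_conj (χ t).ρ g).symm
    · intro s _ hs
      have h := FDRep.char_orthonormal (χ t) (χ s)
      rw [if_neg fun h ↦ hs (hdistinct t s h).symm, mul_eq_zero,
        or_iff_right (inv_ne_zero hG)] at h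
      rw [← h, hchar]
      exact Finset.sum_congr rfl fun g _ ↦
        congrArg _ (character_inv_eq_conj (χ s).ρ g).symm
    · simp
  · intro U V W _ _ _ _ _ _ _ _ _ σ τ ρ e hU hV
    simp_rw [← char_iso e, character_prod, Pi.add_apply, add_mul, Finset.sum_add_distrib]
    rw [hU, hV]

theorem stmt_9 (m : ℕ) (hm : 1 ≤ m) {N : ℕ}
    (χ : Fin N → FDRep ℂ (Equiv.Perm (Fin m)))
    (hsimple : ∀ t, Simple (χ t))
    (hdistinct : ∀ s t : Fin N, Nonempty (χ s ≅ χ t) → s = t)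
    (hcomplete : ∀ W : FDRep ℂ (Equiv.Perm (Fin m)), Simple W → ∃ t, Nonempty (W ≅ χ t))
    (V : FDRep ℂ (Equiv.Perm (Fin m))) (n : ℕ) :
    bV χ V n = (1 / (Nat.factorial m : ℂ)) *
      ∑ σ : Equiv.Perm (Fin m),
        (((Finset.univ.filter fun τ : Equiv.Perm (Fin m) => τ * τ = σ).card : ℂ)) *
          V.character σ ^ n := by
  have : Nonempty (Fin m) := ⟨⟨0, hm⟩⟩
  obtain ⟨W, hW⟩ := V.exists_character_eq_pow n
  have h : ∑ t, ∑ g, W.character g * starRingEnd ℂ ((χ t).character g) =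
      ∑ g, W.character (g * g) :=
    Representation.sum_sum_character_mul_conj_eq χ hsimple hdistinct hcomplete W.ρ
  simp only [bV, ← hW, ← Finset.mul_sum, h, Fintype.card_perm, Fintype.card_fin]
  congr 1
  rw [← Finset.sum_fiberwise (s := Finset.univ) (g := fun τ : Equiv.Perm (Fin m) ↦ τ * τ)]
  refine Finset.sum_congr rfl fun σ _ ↦ ?_
  rw [Finset.sum_congr rfl (g := fun _ ↦ W.character σ)]
  · simp
  · intro τ hτ
    rw [(Finset.mem_filter.1 hτ).2]
end

section
/- Let q be an odd prime power and G = SL(2, F_q), the group of 2×2 matrices of determinant 1 over the field with q elements. Then: (i) the sum of the degrees of the irreducible complex characters of G equals q² + q; (ii) the column sum S(−I) = Σ_t χ_t(−I) at the central element −I equals 2 if q ≡ 1 (mod 4) and 0 if q ≡ 3 (mod 4). Consequently, for every faithful irreducible complex representation V of G (for which Z_V(G) = Z(G) = {±I} and ω_V(−I) = −1), one has for all n ≥ 0: (1/|G|) · Σ_{g ∈ Z_V(G)} S(g) · ω_V(g)^n = (1/(q³−q)) · (q² + q + 2·(−1)^n) if q ≡ 1 (mod 4), and = (q² + q)/(q³−q)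 if q ≡ 3 (mod 4). -/
open CategoryTheory Finset Matrix

open Representation in
theorem FDRep.isIrreducible_of_simple {G : Type} [Group G] (V : FDRep ℂ G) [Simple V] :
    IsIrreducible (V.ρ : Representation ℂ G V) := by
  have hnt : Nontrivial V := by
    by_contra hV
    rw [not_nontrivial_iff_subsingleton] at hV
    apply id_nonzero V
    apply Action.Hom.ext
    ext x
    exact Subsingleton.elim _ _
  have hne : (⊥ : Subrepresentation (V.ρ : Representation ℂ G V)) ≠ ⊤ := by
    intro h
    obtain ⟨v, hv⟩ := exists_ne (0 : V)
    have : v ∈ (⊥ : Subrepresentation (V.ρ : Representation ℂ G V)) := h ▸ Submodule.mem_top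
    exact hv ((Submodule.mem_bot ℂ).1 this)
  refine { exists_pair_ne := ⟨_, _, hne⟩, eq_bot_or_eq_top := fun p => ?_ }
  let f : FDRep.of p.toRepresentation ⟶ V :=
    ⟨InducedCategory.homMk (ModuleCat.ofHom p.toSubmodule.subtype), fun g => by
      ext x; rfl⟩
  have hf : Mono f := ConcreteCategory.mono_of_injective f p.toSubmodule.injective_subtype
  by_cases h0 : f = 0
  · left
    apply Subrepresentation.toSubmodule_injective
    change p.toSubmodule = ⊥
    rw [Submodule.eq_bot_iff]
    intro x hx
    have := congrArg (fun k : FDRep.of p.toRepresentation ⟶ V => k.hom.hom.hom ⟨x, hx⟩) h0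
    exact this
  · right
    have hiso : IsIso f := isIso_of_mono_of_nonzero h0
    apply Subrepresentation.toSubmodule_injective
    change p.toSubmodule = ⊤
    rw [Submodule.eq_top_iff']
    intro x
    have h2 : (inv f ≫ f).hom.hom.hom x = x := by
      rw [IsIso.inv_hom_id]; rfl
    rw [← h2]
    exact ((inv f).hom.hom.hom x).2

open Representation in
theorem FDRep.simple_of_isIrreducible_s11 {G : Type} [Group G] [Fintype G] {V : Type} [AddCommGroup V]
    [Module ℂ V] [FiniteDimensional ℂ V] (ρ : Representation ℂ G V) [IsIrreducible ρ] :
    Simple (FDRep.of ρ) := by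
  have := invertibleOfNonzero (NeZero.ne (Nat.card G : ℂ))
  rw [FDRep.simple_iff_char_is_norm_one]
  have h := card_inv_mul_sum_char_mul_char_eq_finrank ρ ρ
  rw [IsIrreducible.finrank_intertwiningMap_self, Nat.cast_one,
    inv_mul_eq_one₀ (NeZero.ne (Nat.card G : ℂ))] at h
  exact h.symm

open Representation in
theorem Representation.character_eq_add_of_isCompl {k G V : Type*} [Field k] [Group G]
    [AddCommGroup V] [Module k V] [FiniteDimensional k V] (ρ : Representation k G V)
    {p p' : Subrepresentation ρ} (h : IsCompl p.toSubmodule p'.toSubmodule) (g : G) :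
    ρ.character g = p.toRepresentation.character g + p'.toRepresentation.character g := by
  unfold Representation.character
  rw [← LinearMap.trace_prodMap', ← LinearMap.trace_conj' _ (Submodule.prodEquivOfIsCompl _ _ h)]
  congr 1
  ext v
  obtain ⟨w, rfl⟩ := (Submodule.prodEquivOfIsCompl _ _ h).surjective v
  simp [LinearEquiv.conj_apply, Subrepresentation.toRepresentation]

section CompleteFamily

variable {G : Type} [Group G] [Fintype G] {N : ℕ} (χ : Fin N → FDRep ℂ G)

open Representation in
theorem exists_character_eq_sum (hcomplete : ∀ W : FDRep ℂ G, Simple W →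
    ∃ t, Nonempty (W ≅ χ t)) (n : ℕ) : ∀ (V : Type) [AddCommGroup V]
    [Module ℂ V] [FiniteDimensional ℂ V] (ρ : Representation ℂ G V), Module.finrank ℂ V = n →
    ∃ m : Fin N → ℕ, ∀ g, ρ.character g = ∑ t, m t * (χ t).character g := by
  induction n using Nat.strong_induction_on with
  | _ n ih =>
    intro V _ _ _ ρ hn
    by_cases hirr : IsIrreducible ρ
    · obtain ⟨t, ⟨i⟩⟩ := hcomplete _ (FDRep.simple_of_isIrreducible_s11 ρ)
      refine ⟨Pi.single t 1, fun g => ?_⟩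
      have := congrFun (FDRep.char_iso i) g
      simp only [Pi.single_apply, Nat.cast_ite, Nat.cast_one, Nat.cast_zero, ite_mul, one_mul,
        zero_mul, Finset.sum_ite_eq', Finset.mem_univ, if_true]
      exact this
    · by_cases hsub : Subsingleton V
      · refine ⟨0, fun g => ?_⟩
        have : ρ g = 0 := by ext v; exact Subsingleton.elim _ _
        simp [Representation.character, this]
      · rw [not_subsingleton_iff_nontrivial] at hsub
        have hne : (⊥ : Subrepresentation ρ) ≠ ⊤ := by
          intro h
          obtain ⟨v, hv⟩ := exists_ne (0 : V)
          have : v ∈ (⊥ : Subrepresentation ρ) := h ▸ Submodule.mem_top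
          exact hv ((Submodule.mem_bot ℂ).1 this)
        have hnt : Nontrivial (Subrepresentation ρ) := ⟨_, _, hne⟩
        have : ∃ p : Subrepresentation ρ, p ≠ ⊥ ∧ p ≠ ⊤ := by
          by_contra! hcon
          exact hirr { eq_bot_or_eq_top := fun p => or_iff_not_imp_left.2 (hcon p) }
        obtain ⟨p, hp0, hp1⟩ := this
        obtain ⟨p', hp'⟩ := exists_isCompl p
        have hc : IsCompl p.toSubmodule p'.toSubmodule := by
          constructor
          · rw [disjoint_iff, ← Subrepresentation.toSubmodule_inf, hp'.inf_eq_bot]; rfl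
          · rw [codisjoint_iff, ← Subrepresentation.toSubmodule_sup, hp'.sup_eq_top]; rfl
        have hd := Submodule.finrank_add_eq_of_isCompl hc
        have hp0' : 0 < Module.finrank ℂ p.toSubmodule := by
          rw [Nat.pos_iff_ne_zero, Ne, Submodule.finrank_eq_zero]
          exact fun h => hp0 (Subrepresentation.toSubmodule_injective h)
        have hp1' : Module.finrank ℂ p.toSubmodule < n := hn ▸
          Submodule.finrank_lt fun h => hp1 (Subrepresentation.toSubmodule_injective h)
        obtain ⟨m, hm⟩ := ih _ hp1' _ p.toRepresentation rfl
        obtain ⟨m', hm'⟩ := ih _ (by omega) _ p'.toRepresentation rfl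
        refine ⟨m + m', fun g => ?_⟩
        rw [character_eq_add_of_isCompl ρ hc, hm, hm', ← Finset.sum_add_distrib]
        simp [add_mul]

/-- The left regular representation of `G` on complex-valued functions. -/
noncomputable def functionRep (G : Type) [Group G] : Representation ℂ G (G → ℂ) where
  toFun g := LinearMap.funLeft ℂ ℂ (g⁻¹ * ·)
  map_one' := by ext; simp [LinearMap.funLeft]
  map_mul' g h := by ext; simp [LinearMap.funLeft, mul_assoc]

theorem character_functionRep [DecidableEq G] (g : G) :
    (functionRep G).character g = if g = 1 then (Fintype.card G : ℂ) else 0 := by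
  unfold Representation.character
  rw [LinearMap.trace_eq_matrix_trace ℂ (Pi.basisFun ℂ G), Matrix.trace]
  simp only [Matrix.diag_apply, LinearMap.toMatrix_apply, functionRep, MonoidHom.coe_mk,
    OneHom.coe_mk, Pi.basisFun_apply, Pi.basisFun_repr, LinearMap.funLeft_apply, Pi.single_apply,
    mul_eq_right, inv_eq_one]
  split_ifs <;> simp

theorem sum_degree_mul_character [DecidableEq G] (hsimple : ∀ t, Simple (χ t))
    (hdistinct : ∀ s t : Fin N, Nonempty (χ s ≅ χ t) → s = t)
    (hcomplete : ∀ W : FDRep ℂ G, Simple W → ∃ t, Nonempty (W ≅ χ t)) (g : G) :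
    ∑ t, (Module.finrank ℂ (χ t) : ℂ) * (χ t).character g =
      if g = 1 then (Fintype.card G : ℂ) else 0 := by
  have hG := NeZero.ne (Nat.card G : ℂ)
  have := invertibleOfNonzero hG
  obtain ⟨m, hm⟩ := exists_character_eq_sum χ hcomplete _ (G → ℂ) (functionRep G) rfl
  rw [← character_functionRep, hm]
  refine Finset.sum_congr rfl fun s _ => ?_
  congr 1
  have h1 : (Nat.card G : ℂ)⁻¹ * ∑ g, (functionRep G).character g * (χ s).character g⁻¹ =
      Module.finrank ℂ (χ s) := by
    simp only [character_functionRep, ite_mul, zero_mul, Finset.sum_ite_eq', Finset.mem_univ,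
      if_true, inv_one, FDRep.char_one]
    rw [← Nat.card_eq_fintype_card, inv_mul_cancel_left₀ hG]
  rw [← h1]
  simp only [hm, Finset.sum_mul, mul_assoc]
  rw [Finset.sum_comm, Finset.mul_sum]
  classical
  have h2 : ∀ t, (Nat.card G : ℂ)⁻¹ * ∑ g, (m t : ℂ) * ((χ t).character g * (χ s).character g⁻¹)
      = if t = s then (m t : ℂ) else 0 := by
    intro t
    rw [← Finset.mul_sum, mul_left_comm, FDRep.char_orthonormal]
    by_cases hts : t = s
    · subst hts
      rw [if_pos ⟨Iso.refl _⟩]; simp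
    · rw [if_neg (fun h => hts (hdistinct _ _ h)), if_neg hts, mul_zero]
  simp only [h2, Finset.sum_ite_eq', Finset.mem_univ, if_true]

end CompleteFamily
section TwistedIndicator

open Representation Module

variable {G V : Type*} [Group G] [AddCommGroup V] [Module ℂ V] [FiniteDimensional ℂ V]
  (ρ : Representation ℂ G V)

theorem Representation.exists_eq_smul_id_of_commute [IsIrreducible ρ] (T : V →ₗ[ℂ] V)
    (hT : ∀ g, T ∘ₗ ρ g = ρ g ∘ₗ T) : ∃ c : ℂ, T = c • LinearMap.id := by
  obtain ⟨c, hc⟩ := (IsIrreducible.algebraMap_intertwiningMap_bijective_of_isAlgClosed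
    (ρ := ρ)).2 ⟨T, hT⟩
  refine ⟨c, ?_⟩
  have := congrArg IntertwiningMap.toLinearMap hc
  exact this.symm

variable [Fintype G]

theorem Representation.finrank_smul_sum_apply [IsIrreducible ρ] (φ : Dual ℂ V) (v w : V) :
    (finrank ℂ V : ℂ) • ∑ h, φ (ρ h⁻¹ v) • ρ h w = ((Fintype.card G : ℂ) * φ w) • v := by
  set T : V →ₗ[ℂ] V := ∑ h, ρ h ∘ₗ (φ.smulRight w) ∘ₗ ρ h⁻¹ with hT
  have hTv : ∀ v, T v = ∑ h, φ (ρ h⁻¹ v) • ρ h w := by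
    intro v
    simp [hT, LinearMap.sum_apply]
  obtain ⟨c, hc⟩ := ρ.exists_eq_smul_id_of_commute T (by
    intro g
    ext v
    simp only [LinearMap.comp_apply, hTv, map_sum, map_smul]
    refine Fintype.sum_equiv (Equiv.mulLeft g⁻¹) _ _ fun h => ?_
    simp only [Equiv.coe_mulLeft, _root_.mul_inv_rev, inv_inv, map_mul, Module.End.mul_apply,
      ρ.self_inv_apply])
  have htr : LinearMap.trace ℂ V T = (Fintype.card G : ℂ) * φ w := by
    rw [hT, map_sum]
    rw [Finset.sum_congr rfl (g := fun _ => φ w)]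
    · simp
    · intro h _
      rw [LinearMap.trace_comp_comm', LinearMap.comp_assoc]
      have : ρ h⁻¹ ∘ₗ ρ h = LinearMap.id := by
        ext v; simp
      rw [this, LinearMap.comp_id, LinearMap.trace_smulRight]
  rw [← hTv, hc]
  rw [hc, map_smul, LinearMap.trace_id] at htr
  rw [← htr, LinearMap.smul_apply, smul_smul, LinearMap.id_apply, smul_eq_mul, mul_comm]

variable {ρ} {σ : G → G}

theorem Representation.exists_invariant_form [IsIrreducible ρ] (hmul : ∀ g h, σ (g * h) = σ h * σ g)
    (hchar : ∀ g, ρ.character (σ g) = ρ.character g) :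
    ∃ B : V →ₗ[ℂ] Dual ℂ V, Function.Injective B ∧ ∀ g v w, B (ρ g v) w = B v (ρ (σ g) w) := by
  have := invertibleOfNonzero (NeZero.ne (Nat.card G : ℂ))
  have hone : σ 1 = 1 := by simpa using hmul 1 1
  let ρ' : Representation ℂ G (Dual ℂ V) :=
    { toFun := fun g => (ρ (σ g)).dualMap
      map_one' := by ext; simp [hone]
      map_mul' := fun g h => by ext; simp [hmul] }
  have hc : ∀ g, ρ'.character g = ρ.character g := fun g =>
    (LinearMap.trace_transpose' (ρ (σ g))).trans (hchar g)
  have h1 : (finrank ℂ (IntertwiningMap ρ ρ') : ℂ) = 1 := by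
    rw [← card_inv_mul_sum_char_mul_char_eq_finrank]
    simp only [hc]
    rw [card_inv_mul_sum_char_mul_char_eq_finrank, IsIrreducible.finrank_intertwiningMap_self,
      Nat.cast_one]
  have h2 : 0 < finrank ℂ (IntertwiningMap ρ ρ') := by
    rw [Nat.cast_eq_one.1 h1]; exact one_pos
  have : Nontrivial (IntertwiningMap ρ ρ') := Module.nontrivial_of_finrank_pos h2
  obtain ⟨f, hf⟩ := exists_ne (0 : IntertwiningMap ρ ρ')
  refine ⟨f.toLinearMap, (IsIrreducible.injective_or_eq_zero f).resolve_right hf, fun g v w => ?_⟩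
  exact LinearMap.congr_fun (IntertwiningMap.isIntertwining _ _ f g v) w

theorem Representation.exists_symmetric_invariant_form [IsIrreducible ρ]
    (hmul : ∀ g h, σ (g * h) = σ h * σ g) (hinv : ∀ g, σ (σ g) = g)
    (hchar : ∀ g, ρ.character (σ g) = ρ.character g)
    {ι : Type*} [Fintype ι] (c : ι → ℂ) (u : ι → G) (hu : ∀ i, σ (u i) = u i)
    (hne : ∑ i, c i • ρ (u i) ≠ 0)
    (hE : ∀ g, (∑ i, c i • ρ (u i)) * ρ g * (∑ i, c i • ρ (u i)) =
      (∑ i, c i • ρ (u i)) * ρ (σ g) * (∑ i, c i • ρ (u i))) :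
    ∃ B : V →ₗ[ℂ] Dual ℂ V, Function.Injective B ∧ (∀ g v w, B (ρ g v) w = B v (ρ (σ g) w)) ∧
      ∀ v w, B v w = B w v := by
  obtain ⟨B, hB, hBinv⟩ := exists_invariant_form hmul hchar
  refine ⟨B, hB, hBinv, ?_⟩
  have hbij : Function.Bijective B :=
    ⟨hB, (LinearMap.injective_iff_surjective_of_finrank_eq_finrank
      Subspace.dual_finrank_eq.symm).1 hB⟩
  let e := LinearEquiv.ofBijective B hbij
  obtain ⟨d, hd⟩ := ρ.exists_eq_smul_id_of_commute (e.symm.toLinearMap ∘ₗ B.flip) (by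
    intro g
    ext v
    apply hB
    have he : ∀ φ, B (e.symm φ) = φ := e.apply_symm_apply
    ext w
    simp only [LinearMap.comp_apply, LinearEquiv.coe_coe, hBinv, he, LinearMap.flip_apply]
    rw [hinv])
  have hd' : ∀ v w, B w v = d * B v w := by
    intro v w
    have h := congrArg B (LinearMap.congr_fun hd v)
    have he : ∀ φ, B (e.symm φ) = φ := e.apply_symm_apply
    simp only [LinearMap.comp_apply, LinearEquiv.coe_coe, he, LinearMap.smul_apply,
      LinearMap.id_apply, map_smul] at h
    exact LinearMap.congr_fun h w
  by_cases hd1 : d = 1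
  · intro v w
    rw [hd' w v, hd1, one_mul]
  exfalso
  set E := ∑ i, c i • ρ (u i) with hEdef
  have hEadj : ∀ v w, B (E v) w = B v (E w) := by
    intro v w
    simp only [hEdef, LinearMap.sum_apply, LinearMap.smul_apply, map_sum, map_smul, hBinv, hu]
  have hEadj' : ∀ g v w, B (E (ρ g (E v))) w = B v (E (ρ g (E w))) := by
    intro g v w
    rw [hEadj, hBinv, hEadj]
    exact congrArg (B v) (LinearMap.congr_fun (hE g) w).symm
  have hzero : ∀ g v, B (ρ g (E v)) (E v) = 0 := by
    intro g v
    rw [← hEadj]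
    have h1 := hEadj' g v v
    rw [hd' (E (ρ g (E v))) v] at h1
    have h2 : (1 - d) * B (E (ρ g (E v))) v = 0 := by linear_combination h1
    exact (mul_eq_zero.1 h2).resolve_left (sub_ne_zero.2 (Ne.symm hd1))
  apply hne
  ext v
  by_contra hv
  let p : Subrepresentation ρ :=
    { toSubmodule := ⨅ g : G, LinearMap.ker (B.flip (E v) ∘ₗ ρ g)
      apply_mem_toSubmodule := by
        intro g w hw
        simp only [Submodule.mem_iInf, LinearMap.mem_ker, LinearMap.comp_apply] at hw ⊢
        intro h
        simpa using hw (h * g) }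
  have hmem : E v ∈ p := by
    change E v ∈ ⨅ g : G, LinearMap.ker (B.flip (E v) ∘ₗ ρ g)
    simp only [Submodule.mem_iInf, LinearMap.mem_ker, LinearMap.comp_apply]
    exact fun g => hzero g v
  rcases eq_bot_or_eq_top p with h | h
  · rw [h] at hmem
    exact hv ((Submodule.mem_bot ℂ).1 hmem)
  · apply hv
    have : B.flip (E v) = 0 := by
      ext w
      have hw : w ∈ p := h ▸ Submodule.mem_top
      change w ∈ ⨅ g : G, LinearMap.ker (B.flip (E v) ∘ₗ ρ g) at hw
      simp only [Submodule.mem_iInf, LinearMap.mem_ker, LinearMap.comp_apply] at hw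
      simpa using hw 1
    apply hB
    rw [LinearMap.zero_apply, map_zero]
    ext w
    have h3 := hd' w (E v)
    rw [h3, show B w (E v) = 0 from LinearMap.congr_fun this w]
    simp

theorem Representation.finrank_mul_sum_character [IsIrreducible ρ]
    (hmul : ∀ g h, σ (g * h) = σ h * σ g) (hinv : ∀ g, σ (σ g) = g)
    (B : V →ₗ[ℂ] Dual ℂ V) (hB : Function.Injective B)
    (hBinv : ∀ g v w, B (ρ g v) w = B v (ρ (σ g) w)) (hsymm : ∀ v w, B v w = B w v) (x : G) :
    (finrank ℂ V : ℂ) * ∑ g, ρ.character (g * σ g⁻¹ * x) =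
      (Fintype.card G : ℂ) * ρ.character x := by
  have hσ : Function.Bijective σ := Function.Involutive.bijective hinv
  have hone : σ 1 = 1 := by simpa using hmul 1 1
  have hσinv : ∀ g, σ g⁻¹ = (σ g)⁻¹ := fun g =>
    eq_inv_of_mul_eq_one_left (by rw [← hmul, mul_inv_cancel, hone])
  have key : (finrank ℂ V : ℂ) • ∑ g, ρ (g * σ g⁻¹) = (Fintype.card G : ℂ) • LinearMap.id := by
    ext v
    apply hB
    ext w
    let b := Module.finBasis ℂ V
    have hexp : ∀ v w, B v w = ∑ i, b.coord i v * B (b i) w := by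
      intro v w
      have h := congrArg (fun z => B z w) (b.sum_repr v)
      simpa only [map_sum, map_smul, LinearMap.sum_apply, LinearMap.smul_apply, smul_eq_mul,
        Basis.coord_apply] using h.symm
    calc B (((finrank ℂ V : ℂ) • ∑ g, ρ (g * σ g⁻¹)) v) w
        = (finrank ℂ V : ℂ) * ∑ g, B (ρ (σ g)⁻¹ v) (ρ (σ g) w) := by
          simp [LinearMap.sum_apply, hBinv, hσinv]
      _ = (finrank ℂ V : ℂ) * ∑ h, B (ρ h⁻¹ v) (ρ h w) := by
          rw [Function.Bijective.sum_comp hσ (fun h => B (ρ h⁻¹ v) (ρ h w))]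
      _ = ∑ i, B (b i) ((finrank ℂ V : ℂ) • ∑ h, b.coord i (ρ h⁻¹ v) • ρ h w) := by
          simp only [hexp (ρ _⁻¹ v), map_smul, map_sum, smul_eq_mul]
          rw [Finset.sum_comm, Finset.mul_sum]
      _ = ∑ i, (Fintype.card G : ℂ) * (b.coord i w * B (b i) v) := by
          refine Finset.sum_congr rfl fun i _ => ?_
          rw [finrank_smul_sum_apply, map_smul, smul_eq_mul, mul_assoc]
      _ = B (((Fintype.card G : ℂ) • LinearMap.id) v) w := by
          rw [← Finset.mul_sum, ← hexp, hsymm]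
          simp
  have := congrArg (fun T => LinearMap.trace ℂ V (T * ρ x)) key
  simp only [smul_mul_assoc, map_smul, smul_eq_mul, Finset.sum_mul, map_sum, ← map_mul] at this
  exact this

end TwistedIndicator
namespace SL2

section Ring

variable {R : Type*} [CommRing R]

/-- The element of `SL(2, R)` with entries `a, b, c, d`. -/
def mk (a b c d : R) (h : a * d - b * c = 1) : SpecialLinearGroup (Fin 2) R :=
  ⟨!![a, b; c, d], by rw [det_fin_two_of, h]⟩

theorem ext_entries {g h : SpecialLinearGroup (Fin 2) R} (h00 : g 0 0 = h 0 0)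
    (h01 : g 0 1 = h 0 1) (h10 : g 1 0 = h 1 0) (h11 : g 1 1 = h 1 1) : g = h := by
  ext i j
  fin_cases i <;> fin_cases j <;> assumption

theorem det_eq (g : SpecialLinearGroup (Fin 2) R) : g 0 0 * g 1 1 - g 0 1 * g 1 0 = 1 := by
  rw [← det_fin_two]; exact g.2

section entries

variable (a b c d : R) (h : a * d - b * c = 1)

@[simp] theorem mk_00 : mk a b c d h 0 0 = a := rfl
@[simp] theorem mk_01 : mk a b c d h 0 1 = b := rfl
@[simp] theorem mk_10 : mk a b c d h 1 0 = c := rfl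
@[simp] theorem mk_11 : mk a b c d h 1 1 = d := rfl

end entries

theorem mul_entry (g h : SpecialLinearGroup (Fin 2) R) (i j : Fin 2) :
    (g * h) i j = g i 0 * h 0 j + g i 1 * h 1 j := by
  change (g.1 * h.1) i j = _
  rw [mul_apply, Fin.sum_univ_two]

/-- The upper unipotent element with upper right entry `x`. -/
def upper (x : R) : SpecialLinearGroup (Fin 2) R := mk 1 x 0 1 (by ring)

/-- The lower unipotent element with lower left entry `x`. -/
def lower (x : R) : SpecialLinearGroup (Fin 2) R := mk 1 0 x 1 (by ring)

/-- The standard Weyl element. -/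
def weyl : SpecialLinearGroup (Fin 2) R := mk 0 1 (-1) 0 (by ring)

/-- The anti-automorphism of `SL(2, R)` exchanging the two diagonal entries. -/
def swapDiag (g : SpecialLinearGroup (Fin 2) R) : SpecialLinearGroup (Fin 2) R :=
  mk (g 1 1) (g 0 1) (g 1 0) (g 0 0) (by linear_combination det_eq g)

theorem swapDiag_mul (g h : SpecialLinearGroup (Fin 2) R) :
    swapDiag (g * h) = swapDiag h * swapDiag g := by
  apply ext_entries <;> simp only [swapDiag, mul_entry, mk_00, mk_01, mk_10, mk_11] <;> ring

theorem swapDiag_swapDiag (g : SpecialLinearGroup (Fin 2) R) : swapDiag (swapDiag g) = g :=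
  ext_entries rfl rfl rfl rfl

theorem swapDiag_upper (x : R) : swapDiag (upper x) = upper x :=
  ext_entries rfl rfl rfl rfl

theorem upper_add (x y : R) : upper (x + y) = upper x * upper y := by
  apply ext_entries <;> simp [upper, mul_entry, add_comm]

theorem upper_zero : upper (0 : R) = 1 := by
  apply ext_entries <;> simp [upper]

theorem lower_eq (x : R) : lower x * weyl = weyl * upper (-x) := by
  apply ext_entries <;> simp [lower, upper, weyl, mul_entry]

end Ring

section Field

variable {F : Type*} [Field F]

theorem swapDiag_eq_conj_upper (g : SpecialLinearGroup (Fin 2) F) (hc : g 1 0 ≠ 0) :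
    swapDiag g = upper ((g 1 1 - g 0 0) / g 1 0) * g * upper (-((g 1 1 - g 0 0) / g 1 0)) := by
  have h := det_eq g
  apply ext_entries <;> simp only [swapDiag, upper, mul_entry, mk_00, mk_01, mk_10, mk_11] <;>
    field_simp <;> ring

theorem isConj_swapDiag (g : SpecialLinearGroup (Fin 2) F) : IsConj g (swapDiag g) := by
  rw [isConj_iff]
  by_cases hc : g 1 0 = 0
  · by_cases hb : g 0 1 = 0
    · refine ⟨weyl, ?_⟩
      rw [mul_inv_eq_iff_eq_mul]
      apply ext_entries <;> simp [swapDiag, weyl, mul_entry, hb, hc]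
    · refine ⟨lower ((g 0 0 - g 1 1) / g 0 1), ?_⟩
      rw [mul_inv_eq_iff_eq_mul]
      apply ext_entries <;> simp only [swapDiag, lower, mul_entry, mk_00, mk_01, mk_10, mk_11] <;>
        field_simp <;> ring
  · refine ⟨upper ((g 1 1 - g 0 0) / g 1 0), ?_⟩
    rw [swapDiag_eq_conj_upper g hc]
    congr 1
    rw [inv_eq_iff_mul_eq_one, ← upper_add, add_neg_cancel, upper_zero]

theorem map_eq_one_of_upper {M : Type*} [Monoid M] (f : SpecialLinearGroup (Fin 2) F →* M)
    (hf : ∀ x, f (upper x) = 1) (g : SpecialLinearGroup (Fin 2) F) : f g = 1 := by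
  have hl : ∀ x, f (lower x) = 1 := by
    intro x
    have : lower x = weyl * upper (-x) * weyl⁻¹ := by rw [← lower_eq, mul_inv_cancel_right]
    rw [this, map_mul, map_mul, hf, mul_one, ← map_mul, mul_inv_cancel, map_one]
  have hne : ∀ g : SpecialLinearGroup (Fin 2) F, g 1 0 ≠ 0 → f g = 1 := by
    intro g hc
    have h := det_eq g
    have : g = upper ((g 0 0 - 1) / g 1 0) * lower (g 1 0) * upper ((g 1 1 - 1) / g 1 0) := by
      apply ext_entries <;> simp only [lower, upper, mul_entry, mk_00, mk_01, mk_10, mk_11] <;>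
        field_simp <;> first | linear_combination -h | ring
    rw [this, map_mul, map_mul, hf, hf, hl, one_mul, one_mul]
  by_cases hc : g 1 0 = 0
  · have h := det_eq g
    have hd : g 1 1 ≠ 0 := by
      intro hd
      rw [hc, hd] at h
      simp at h
    have h1 := hne (g * lower 1) (by simp [mul_entry, lower, hc, hd])
    rwa [map_mul, hl, mul_one] at h1
  · exact hne g hc

end Field

section Whittaker

open Representation

variable {F : Type*} [Field F] [Fintype F] {V : Type*} [AddCommGroup V] [Module ℂ V]
  (ρ : Representation ℂ (SpecialLinearGroup (Fin 2) F) V) (ψ : AddChar F ℂ)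

/-- The (unnormalised) projection onto the `ψ`-isotypic part for the upper unipotent subgroup. -/
noncomputable def whittakerProj : V →ₗ[ℂ] V := ∑ x, ψ (-x) • ρ (upper x)

theorem upper_mul_whittakerProj (y : F) :
    ρ (upper y) * whittakerProj ρ ψ = ψ y • whittakerProj ρ ψ := by
  rw [whittakerProj, Finset.mul_sum, Finset.smul_sum]
  refine Fintype.sum_equiv (Equiv.addLeft y) _ _ fun x => ?_
  rw [mul_smul_comm, ← map_mul, ← upper_add, smul_smul, ← AddChar.map_add_eq_mul]
  simp

theorem whittakerProj_mul_upper (y : F) :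
    whittakerProj ρ ψ * ρ (upper y) = ψ y • whittakerProj ρ ψ := by
  rw [← upper_mul_whittakerProj, whittakerProj, Finset.mul_sum, Finset.sum_mul]
  refine Finset.sum_congr rfl fun x _ => ?_
  rw [smul_mul_assoc, mul_smul_comm, ← map_mul, ← map_mul, ← upper_add, ← upper_add, add_comm]

theorem whittakerProj_borel_whittakerProj (hψ : ψ ≠ 1) (g : SpecialLinearGroup (Fin 2) F)
    (hc : g 1 0 = 0) (hne : g 0 0 ≠ g 1 1) :
    whittakerProj ρ ψ * ρ g * whittakerProj ρ ψ = 0 := by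
  have h := det_eq g
  rw [hc, mul_zero, sub_zero] at h
  have hd : g 1 1 ≠ 0 := right_ne_zero_of_mul_eq_one h
  by_contra hne0
  apply hψ
  ext y
  set z := y / (1 - g 0 0 / g 1 1) with hz
  have hden : (1 - g 0 0 / g 1 1) ≠ 0 := by
    rw [sub_ne_zero, ne_comm, Ne, div_eq_one_iff_eq hd]; exact hne
  have hcomm : g * upper z = upper (z * (g 0 0 / g 1 1)) * g := by
    apply ext_entries <;> simp only [upper, mul_entry, mk_00, mk_01, mk_10, mk_11, hc] <;>
      field_simp <;> ring
  have h1 : ψ z • (whittakerProj ρ ψ * ρ g * whittakerProj ρ ψ) =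
      ψ (z * (g 0 0 / g 1 1)) • (whittakerProj ρ ψ * ρ g * whittakerProj ρ ψ) := by
    rw [← mul_smul_comm, ← upper_mul_whittakerProj, ← mul_assoc, mul_assoc _ (ρ g), ← map_mul,
      hcomm, map_mul, ← mul_assoc, whittakerProj_mul_upper, smul_mul_assoc, smul_mul_assoc]
  have h2 := smul_left_injective ℂ hne0 h1
  have h3 : y = z - z * (g 0 0 / g 1 1) := by
    rw [hz]; field_simp
  rw [h3, AddChar.map_sub_eq_div, h2, div_self (AddChar.val_isUnit ψ _).ne_zero, AddChar.one_apply]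

theorem whittakerProj_mul_mul (hψ : ψ ≠ 1) (g : SpecialLinearGroup (Fin 2) F) :
    whittakerProj ρ ψ * ρ g * whittakerProj ρ ψ =
      whittakerProj ρ ψ * ρ (swapDiag g) * whittakerProj ρ ψ := by
  by_cases hc : g 1 0 = 0
  · by_cases hne : g 0 0 = g 1 1
    · congr 3
      exact ext_entries hne rfl rfl hne.symm
    · rw [whittakerProj_borel_whittakerProj ρ ψ hψ g hc hne,
        whittakerProj_borel_whittakerProj ρ ψ hψ (swapDiag g) hc (Ne.symm hne)]
  · rw [swapDiag_eq_conj_upper g hc, map_mul, map_mul, ← mul_assoc, ← mul_assoc,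
      whittakerProj_mul_upper, mul_assoc _ (ρ (upper _)), upper_mul_whittakerProj,
      smul_mul_assoc, smul_mul_assoc, mul_smul_comm, smul_smul, ← AddChar.map_add_eq_mul,
      add_neg_cancel, AddChar.map_zero_eq_one, one_smul]

theorem apply_upper_eq_one_of_whittakerProj_eq_zero
    (h : ∀ ψ : AddChar F ℂ, ψ ≠ 1 → whittakerProj ρ ψ = 0) (y : F) : ρ (upper y) = 1 := by
  classical
  have h1 : ∑ ψ : AddChar F ℂ, whittakerProj ρ ψ = (Fintype.card F : ℂ) • 1 := by
    simp only [whittakerProj]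
    rw [Finset.sum_comm]
    simp only [← Finset.sum_smul, AddChar.sum_apply_eq_ite, neg_eq_zero, ite_smul, zero_smul,
      Finset.sum_ite_eq', Finset.mem_univ, if_true, upper_zero, map_one]
  rw [Finset.sum_eq_single 1 (fun ψ _ hψ => h ψ hψ) (by simp)] at h1
  have h2 := upper_mul_whittakerProj ρ 1 y
  rw [h1, AddChar.one_apply, one_smul, mul_smul_comm, mul_one] at h2
  exact smul_right_injective _ (Nat.cast_ne_zero.2 Fintype.card_ne_zero) h2

theorem exists_symmetric_form [FiniteDimensional ℂ V] [IsIrreducible ρ] [DecidableEq F] :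
    ∃ B : V →ₗ[ℂ] Module.Dual ℂ V, Function.Injective B ∧
      (∀ g v w, B (ρ g v) w = B v (ρ (swapDiag g) w)) ∧ ∀ v w, B v w = B w v := by
  have hchar : ∀ g, ρ.character (swapDiag g) = ρ.character g := by
    intro g
    obtain ⟨c, hc⟩ := isConj_iff.1 (isConj_swapDiag g)
    rw [← hc, char_conj]
  by_cases h : ∃ ψ : AddChar F ℂ, ψ ≠ 1 ∧ whittakerProj ρ ψ ≠ 0
  · obtain ⟨ψ, hψ, hne⟩ := h
    exact exists_symmetric_invariant_form swapDiag_mul swapDiag_swapDiag hchar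
      (fun x => ψ (-x)) upper swapDiag_upper hne (whittakerProj_mul_mul ρ ψ hψ)
  · push Not at h
    have htriv := map_eq_one_of_upper ρ (apply_upper_eq_one_of_whittakerProj_eq_zero ρ h)
    have hone : swapDiag (1 : SpecialLinearGroup (Fin 2) F) = 1 := ext_entries rfl rfl rfl rfl
    refine exists_symmetric_invariant_form swapDiag_mul swapDiag_swapDiag hchar
      (fun _ : Unit => 1) (fun _ => 1) (fun _ => hone) ?_ fun g => by simp only [htriv]
    have hnt : Nontrivial V := by
      by_contra hV
      rw [not_nontrivial_iff_subsingleton] at hV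
      exact bot_ne_top (α := Subrepresentation ρ)
        (Subrepresentation.toSubmodule_injective (Subsingleton.elim _ _))
    simp

end Whittaker

end SL2

theorem colSum_eq_card {F : Type} [Field F] [Fintype F] [DecidableEq F] {N : ℕ}
    (χ : Fin N → FDRep ℂ (SpecialLinearGroup (Fin 2) F)) (hsimple : ∀ t, Simple (χ t))
    (hdistinct : ∀ s t : Fin N, Nonempty (χ s ≅ χ t) → s = t)
    (hcomplete : ∀ W : FDRep ℂ (SpecialLinearGroup (Fin 2) F), Simple W →
      ∃ t, Nonempty (W ≅ χ t)) (x : SpecialLinearGroup (Fin 2) F) :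
    colSum χ x = #{g | g * SL2.swapDiag g⁻¹ * x = 1} := by
  have hG : (Fintype.card (SpecialLinearGroup (Fin 2) F) : ℂ) ≠ 0 :=
    Nat.cast_ne_zero.2 Fintype.card_ne_zero
  apply mul_left_cancel₀ hG
  have hirr := fun t => FDRep.isIrreducible_of_simple (χ t)
  have h1 : ∀ t, (Fintype.card (SpecialLinearGroup (Fin 2) F) : ℂ) * (χ t).character x =
      (Module.finrank ℂ (χ t) : ℂ) * ∑ g, (χ t).character (g * SL2.swapDiag g⁻¹ * x) := by
    intro t
    obtain ⟨B, hB, hBinv, hsymm⟩ := SL2.exists_symmetric_form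
      ((χ t).ρ : Representation ℂ (SpecialLinearGroup (Fin 2) F) (χ t))
    exact (Representation.finrank_mul_sum_character SL2.swapDiag_mul SL2.swapDiag_swapDiag
      B hB hBinv hsymm x).symm
  rw [colSum, Finset.mul_sum]
  simp only [h1, Finset.mul_sum]
  rw [Finset.sum_comm]
  simp only [sum_degree_mul_character χ hsimple hdistinct hcomplete]
  rw [← Finset.sum_filter, Finset.sum_const, nsmul_eq_mul, mul_comm]

namespace SL2

section Counting

variable {F : Type*} [Field F] [Fintype F] [DecidableEq F]

theorem sum_ite_eq_zero (A B : ℂ) :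
    ∑ b : F, (if b = 0 then A else B) = A + ((Fintype.card F : ℂ) - 1) * B := by
  have h : ∀ b : F, (if b = 0 then A else B) = (if b = 0 then A - B else 0) + B := by
    intro b; split_ifs <;> ring
  simp only [h, Finset.sum_add_distrib, Finset.sum_ite_eq', Finset.mem_univ, if_true,
    Finset.sum_const, Finset.card_univ, nsmul_eq_mul]
  ring

theorem sum_boole_linear (u b v : F) :
    ∑ c : F, (if u + b * c = v then (1 : ℂ) else 0) =
      if b = 0 then (if u = v then (Fintype.card F : ℂ) else 0) else 1 := by
  by_cases hb : b = 0
  · simp [hb]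
  · have h : ∀ c : F, u + b * c = v ↔ c = (v - u) / b := by
      intro c
      rw [eq_div_iff hb, eq_sub_iff_add_eq, add_comm, mul_comm]
    simp [h, hb]

theorem card_sq_eq_one (h2 : (2 : F) ≠ 0) : #{a : F | a * a = 1} = 2 := by
  have : ({a : F | a * a = 1} : Finset F) = {1, -1} := by
    ext a; simp [mul_self_eq_one_iff]
  rw [this, Finset.card_pair]
  intro h
  apply h2
  linear_combination h

theorem card_sq_eq_neg_one (h2 : (2 : F) ≠ 0) (h : Fintype.card F % 4 = 1) :
    #{a : F | a * a = -1} = 2 := by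
  obtain ⟨i, hi⟩ := FiniteField.isSquare_neg_one_iff.2 (by omega : Fintype.card F % 4 ≠ 3)
  have : ({a : F | a * a = -1} : Finset F) = {i, -i} := by
    ext a; simp [hi, mul_self_eq_mul_self_iff]
  rw [this, Finset.card_pair]
  intro h
  have h0 : i = 0 := by
    apply (mul_eq_zero.1 _).resolve_left h2
    linear_combination h
  simp [h0] at hi

theorem card_sq_eq_neg_one_of_three (h : Fintype.card F % 4 = 3) :
    #{a : F | a * a = -1} = 0 := by
  rw [Finset.card_eq_zero, Finset.filter_eq_empty_iff]
  intro a _ ha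
  exact FiniteField.isSquare_neg_one_iff.1 ⟨a, ha.symm⟩ h

theorem card_eq : (Fintype.card (SpecialLinearGroup (Fin 2) F) : ℂ) =
    (Fintype.card F : ℂ) ^ 3 - Fintype.card F := by
  have hcard : Fintype.card (SpecialLinearGroup (Fin 2) F) =
      #{p : F × F × F × F | -(p.2.1 * p.2.2.1) + p.1 * p.2.2.2 = 1} := by
    rw [← Finset.card_univ]
    refine Finset.card_bij' (fun g _ => (g 0 0, g 0 1, g 1 0, g 1 1))
      (fun p hp => mk p.1 p.2.1 p.2.2.1 p.2.2.2
        (by have := (Finset.mem_filter.1 hp).2; linear_combination this)) ?_ ?_ ?_ ?_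
    · intro g _
      simp only [Finset.mem_filter, Finset.mem_univ, true_and]
      linear_combination det_eq g
    · intros; exact Finset.mem_univ _
    · intro g _; exact ext_entries rfl rfl rfl rfl
    · intros; rfl
  have h0 : ∀ b c : F, -(b * c) = 1 ↔ 0 + b * c = -1 := by
    intro b c; rw [zero_add, neg_eq_iff_eq_neg]
  rw [hcard, Finset.natCast_card_filter, Fintype.sum_prod_type]
  simp only [Fintype.sum_prod_type, sum_boole_linear]
  have h1 : ∀ a : F, ∑ b : F, ∑ c : F, (if a = 0 then (if -(b * c) = 1 then (Fintype.card F : ℂ)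
      else 0) else 1) = if a = 0 then (Fintype.card F : ℂ) * (Fintype.card F - 1) else
      (Fintype.card F : ℂ) ^ 2 := by
    intro a
    by_cases ha : a = 0
    · have h3 : ∀ b c : F, (if -(b * c) = 1 then (Fintype.card F : ℂ) else 0) =
          Fintype.card F * (if 0 + b * c = -1 then 1 else 0) := by
        intro b c; simp [h0]
      simp only [ha, if_true, h3, ← Finset.mul_sum, sum_boole_linear, sum_ite_eq_zero]
      simp
    · simp [ha, sq]
  simp only [h1, sum_ite_eq_zero]
  ring

theorem card_swapDiag_eq_self (h2 : (2 : F) ≠ 0) :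
    (#{g : SpecialLinearGroup (Fin 2) F | g 0 0 = g 1 1} : ℂ) =
      (Fintype.card F : ℂ) ^ 2 + Fintype.card F := by
  have hcard : #{g : SpecialLinearGroup (Fin 2) F | g 0 0 = g 1 1} =
      #{p : F × F × F | p.1 * p.1 + (-p.2.1) * p.2.2 = 1} := by
    refine Finset.card_bij' (fun g _ => (g 0 0, g 0 1, g 1 0))
      (fun p hp => mk p.1 p.2.1 p.2.2 p.1
        (by have := (Finset.mem_filter.1 hp).2; linear_combination this)) ?_ ?_ ?_ ?_
    · intro g hg
      have hg := (Finset.mem_filter.1 hg).2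
      simp only [Finset.mem_filter, Finset.mem_univ, true_and]
      linear_combination det_eq g + g 0 0 * hg
    · intros; simp
    · intro g hg
      exact ext_entries rfl rfl rfl (Finset.mem_filter.1 hg).2
    · intros; rfl
  rw [hcard, Finset.natCast_card_filter, Fintype.sum_prod_type]
  simp only [Fintype.sum_prod_type, sum_boole_linear, neg_eq_zero, sum_ite_eq_zero]
  have h3 : ∀ a : F, (if a * a = 1 then (Fintype.card F : ℂ) else 0) =
      Fintype.card F * (if a * a = 1 then 1 else 0) := by
    intro a; simp
  rw [Finset.sum_add_distrib]
  simp only [h3, ← Finset.mul_sum]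
  rw [← Finset.natCast_card_filter, card_sq_eq_one h2]
  simp
  ring

theorem card_swapDiag_eq_neg (h2 : (2 : F) ≠ 0) :
    #{g : SpecialLinearGroup (Fin 2) F |
      g 0 0 = -g 1 1 ∧ g 0 1 = -g 0 1 ∧ g 1 0 = -g 1 0} = #{a : F | a * a = -1} := by
  have hz : ∀ x : F, x = -x → x = 0 := by
    intro x hx
    apply (mul_eq_zero.1 _).resolve_left h2
    linear_combination hx
  refine Finset.card_bij' (fun g _ => g 0 0) (fun a ha => mk a 0 0 (-a)
      (by have := (Finset.mem_filter.1 ha).2; linear_combination -this)) ?_ ?_ ?_ ?_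
  · intro g hg
    obtain ⟨h1, hb, hc⟩ := (Finset.mem_filter.1 hg).2
    simp only [Finset.mem_filter, Finset.mem_univ, true_and]
    have := det_eq g
    rw [hz _ hb] at this
    linear_combination -this + g 0 0 * h1
  · intros; simp
  · intro g hg
    obtain ⟨h1, hb, hc⟩ := (Finset.mem_filter.1 hg).2
    exact ext_entries rfl (hz _ hb).symm (hz _ hc).symm (by simp [h1])
  · intros; rfl

end Counting

theorem swapDiag_inv {R : Type*} [CommRing R] (g : SpecialLinearGroup (Fin 2) R) :
    swapDiag g⁻¹ = (swapDiag g)⁻¹ := by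
  apply eq_inv_of_mul_eq_one_left
  rw [← swapDiag_mul, mul_inv_cancel]
  exact ext_entries rfl rfl rfl rfl

theorem eq_one_or_eq_neg_one_of_central {F : Type*} [Field F] [Fact (Even (Fintype.card (Fin 2)))]
    (g : SpecialLinearGroup (Fin 2) F) (hg : ∀ h, g * h = h * g) : g = 1 ∨ g = -1 := by
  have e := fun (h : SpecialLinearGroup (Fin 2) F) i j =>
    congrArg (fun k : SpecialLinearGroup (Fin 2) F => k i j) (hg h)
  simp only [mul_entry] at e
  have h1 := e (upper 1) 0 0
  have h2 := e (upper 1) 0 1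
  have h3 := e (lower 1) 0 0
  simp only [upper, lower, mk_00, mk_01, mk_10, mk_11] at h1 h2 h3
  have hc : g 1 0 = 0 := by linear_combination -h1
  have had : g 0 0 = g 1 1 := by linear_combination h2
  have hb : g 0 1 = 0 := by linear_combination h3
  have hdet := det_eq g
  rw [hb, ← had] at hdet
  have : g 0 0 = 1 ∨ g 0 0 = -1 := mul_self_eq_one_iff.1 (by linear_combination hdet)
  rcases this with h | h
  · left
    apply ext_entries <;> simp [hb, hc, ← had, h]
  · right
    apply ext_entries <;> simp [hb, hc, ← had, h]

end SL2

theorem colSum_one {F : Type} [Field F] [Fintype F] [DecidableEq F] {N : ℕ}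
    (χ : Fin N → FDRep ℂ (SpecialLinearGroup (Fin 2) F)) (hsimple : ∀ t, Simple (χ t))
    (hdistinct : ∀ s t : Fin N, Nonempty (χ s ≅ χ t) → s = t)
    (hcomplete : ∀ W : FDRep ℂ (SpecialLinearGroup (Fin 2) F), Simple W →
      ∃ t, Nonempty (W ≅ χ t)) (h2 : (2 : F) ≠ 0) :
    colSum χ 1 = (Fintype.card F : ℂ) ^ 2 + Fintype.card F := by
  rw [colSum_eq_card χ hsimple hdistinct hcomplete, ← SL2.card_swapDiag_eq_self h2]
  congr 2
  ext g
  simp only [Finset.mem_filter, Finset.mem_univ, true_and]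
  rw [mul_one, SL2.swapDiag_inv, mul_inv_eq_one]
  exact ⟨fun h => congrArg (fun k : SpecialLinearGroup (Fin 2) F => k 0 0) h,
    fun h => SL2.ext_entries h rfl rfl h.symm⟩

theorem colSum_neg_one {F : Type} [Field F] [Fintype F] [DecidableEq F]
    [Fact (Even (Fintype.card (Fin 2)))] {N : ℕ}
    (χ : Fin N → FDRep ℂ (SpecialLinearGroup (Fin 2) F)) (hsimple : ∀ t, Simple (χ t))
    (hdistinct : ∀ s t : Fin N, Nonempty (χ s ≅ χ t) → s = t)
    (hcomplete : ∀ W : FDRep ℂ (SpecialLinearGroup (Fin 2) F), Simple W →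
      ∃ t, Nonempty (W ≅ χ t)) (h2 : (2 : F) ≠ 0) :
    colSum χ (-1) = #{a : F | a * a = -1} := by
  rw [colSum_eq_card χ hsimple hdistinct hcomplete, ← SL2.card_swapDiag_eq_neg h2]
  congr 2
  ext g
  simp only [Finset.mem_filter, Finset.mem_univ, true_and]
  have : g * SL2.swapDiag g⁻¹ * -1 = 1 ↔ g = -SL2.swapDiag g := by
    rw [SL2.swapDiag_inv, mul_neg, mul_one, neg_eq_iff_eq_neg, mul_inv_eq_iff_eq_mul, neg_mul,
      one_mul]
  rw [this]
  constructor
  · intro h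
    have e := fun i j => congrArg (fun k : SpecialLinearGroup (Fin 2) F => k i j) h
    exact ⟨e 0 0, e 0 1, e 1 0⟩
  · rintro ⟨h1, h3, h4⟩
    exact SL2.ext_entries h1 h3 h4 (by simp [SL2.swapDiag, h1])

theorem exists_scalar_of_central {G : Type} [Group G] [Fintype G] (V : FDRep ℂ G) [Simple V]
    (z : G) (hz : ∀ g, z * g = g * z) : ∃ c : ℂ, V.ρ z = c • LinearMap.id := by
  have := FDRep.isIrreducible_of_simple V
  refine Representation.exists_eq_smul_id_of_commute (V.ρ : Representation ℂ G V) _ fun g => ?_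
  rw [← Module.End.mul_eq_comp, ← Module.End.mul_eq_comp, ← map_mul, hz, map_mul]

theorem sum_scalars_faithful {F : Type} [Field F] [Fintype F]
    [Fact (Even (Fintype.card (Fin 2)))] (h2 : (2 : F) ≠ 0)
    (V : FDRep ℂ (SpecialLinearGroup (Fin 2) F)) (hinj : Function.Injective V.ρ) (hV : Simple V)
    (ZV : Finset (SpecialLinearGroup (Fin 2) F)) (ωV : SpecialLinearGroup (Fin 2) F → ℂ)
    (hZ : ∀ g, g ∈ ZV ↔ ∃ c : ℂ, V.ρ g = c • LinearMap.id)
    (hω : ∀ g ∈ ZV, V.ρ g = ωV g • LinearMap.id)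
    (S : SpecialLinearGroup (Fin 2) F → ℂ) (n : ℕ) :
    ∑ g ∈ ZV, S g * ωV g ^ n = S 1 + S (-1) * (-1) ^ n := by
  classical
  have hne : (1 : SpecialLinearGroup (Fin 2) F) ≠ -1 := by
    intro h
    have h00 : (1 : F) = -1 := by
      simpa using congrArg (fun k : SpecialLinearGroup (Fin 2) F => k 0 0) h
    exact h2 (by linear_combination h00)
  have hone : (1 : SpecialLinearGroup (Fin 2) F) ∈ ZV := (hZ 1).2
    ⟨1, by rw [map_one, one_smul]; rfl⟩
  have hneg : (-1 : SpecialLinearGroup (Fin 2) F) ∈ ZV :=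
    (hZ _).2 (exists_scalar_of_central V _ fun g => by rw [neg_one_mul, mul_neg_one])
  have hZV : ZV = {1, -1} := by
    ext g
    rw [Finset.mem_insert, Finset.mem_singleton]
    refine ⟨fun hg => SL2.eq_one_or_eq_neg_one_of_central g fun h => hinj ?_, ?_⟩
    · rw [map_mul, map_mul, hω g hg]
      ext v
      simp
    · rintro (rfl | rfl) <;> assumption
  have hirr := FDRep.isIrreducible_of_simple V
  have hnt : Nontrivial V := by
    by_contra hV
    rw [not_nontrivial_iff_subsingleton] at hV
    exact hne (hinj (LinearMap.ext fun v => Subsingleton.elim _ _))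
  have hid : (LinearMap.id : V →ₗ[ℂ] V) ≠ 0 := one_ne_zero
  have hω1 : ωV 1 = 1 := by
    apply smul_left_injective ℂ hid
    change ωV 1 • LinearMap.id = (1 : ℂ) • LinearMap.id
    rw [← hω 1 hone, map_one, one_smul]
    rfl
  have hωneg : ωV (-1) = -1 := by
    have hsq : ωV (-1) * ωV (-1) = 1 := by
      apply smul_left_injective ℂ hid
      change (ωV (-1) * ωV (-1)) • LinearMap.id = (1 : ℂ) • LinearMap.id
      have h : V.ρ (-1) * V.ρ (-1) = 1 := by rw [← map_mul, neg_mul_neg, one_mul, map_one]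
      rw [hω _ hneg] at h
      rw [one_smul, mul_smul]
      exact h
    refine (mul_self_eq_one_iff.1 hsq).resolve_left fun h => hne (hinj ?_)
    rw [hω _ hneg, h, map_one, one_smul]
    rfl
  rw [hZV, Finset.sum_pair hne, hω1, hωneg, one_pow, mul_one]

theorem stmt_11 (q : ℕ) (hqodd : Odd q)
    (hq : ∃ (p r : ℕ), p.Prime ∧ 0 < r ∧ q = p ^ r)
    (F : Type) [Field F] [Fintype F] [DecidableEq F] (hF : Fintype.card F = q)
    [Fact (Even (Fintype.card (Fin 2)))] {N : ℕ}
    (χ : Fin N → FDRep ℂ (SpecialLinearGroup (Fin 2) F))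
    (hsimple : ∀ t, Simple (χ t))
    (hdistinct : ∀ s t : Fin N, Nonempty (χ s ≅ χ t) → s = t)
    (hcomplete : ∀ W : FDRep ℂ (SpecialLinearGroup (Fin 2) F), Simple W →
      ∃ t, Nonempty (W ≅ χ t)) :
    -- (i) the sum of the degrees of the irreducible characters is q² + q
    (∑ t, (χ t).character 1 = ((q : ℂ) ^ 2 + q)) ∧
    -- (ii) the column sum at -I is 2 if q ≡ 1 (mod 4), and 0 if q ≡ 3 (mod 4)
    (q % 4 = 1 → colSum χ (-1) = 2) ∧
    (q % 4 = 3 → colSum χ (-1) = 0) ∧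
    -- consequently, the asymptotic coefficient for a faithful irreducible module
    (∀ V : FDRep ℂ (SpecialLinearGroup (Fin 2) F),
      Function.Injective V.ρ → Simple V →
      ∀ (ZV : Finset (SpecialLinearGroup (Fin 2) F))
        (ωV : SpecialLinearGroup (Fin 2) F → ℂ),
        (∀ g, g ∈ ZV ↔ ∃ c : ℂ, V.ρ g = c • LinearMap.id) →
        (∀ g ∈ ZV, V.ρ g = ωV g • LinearMap.id) →
        ∀ n : ℕ,
          (q % 4 = 1 →
            (1 / (Fintype.card (SpecialLinearGroup (Fin 2) F) : ℂ)) *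
              ∑ g ∈ ZV, colSum χ g * ωV g ^ n =
            (1 / ((q : ℂ) ^ 3 - q)) * ((q : ℂ) ^ 2 + q + 2 * (-1 : ℂ) ^ n)) ∧
          (q % 4 = 3 →
            (1 / (Fintype.card (SpecialLinearGroup (Fin 2) F) : ℂ)) *
              ∑ g ∈ ZV, colSum χ g * ωV g ^ n =
            ((q : ℂ) ^ 2 + q) / ((q : ℂ) ^ 3 - q))) := by
  subst hF
  have h2 : (2 : F) ≠ 0 := by
    apply Ring.two_ne_zero
    intro h
    exact (Nat.not_even_iff_odd.2 hqodd) (Nat.even_iff.2 (FiniteField.even_card_of_char_two h))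
  have h1 := colSum_one χ hsimple hdistinct hcomplete h2
  have hneg := colSum_neg_one χ hsimple hdistinct hcomplete h2
  have hneg1 : Fintype.card F % 4 = 1 → colSum χ (-1) = 2 := by
    intro h
    rw [hneg, SL2.card_sq_eq_neg_one h2 h]
    norm_num
  have hneg3 : Fintype.card F % 4 = 3 → colSum χ (-1) = 0 := by
    intro h
    rw [hneg, SL2.card_sq_eq_neg_one_of_three h, Nat.cast_zero]
  refine ⟨h1, hneg1, hneg3, fun V hinj hV ZV ωV hZ hω n => ⟨fun h => ?_, fun h => ?_⟩⟩
  · rw [sum_scalars_faithful h2 V hinj hV ZV ωV hZ hω, SL2.card_eq, h1, hneg1 h]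
  · rw [sum_scalars_faithful h2 V hinj hV ZV ωV hZ hω, SL2.card_eq, h1, hneg3 h, zero_mul, add_zero,
      one_div_mul_eq_div]
end

section
/- Let p be a prime and j, k positive integers with k − j ≥ j. Let G be the group of order p^{k+j} given by the semidirect product C_{p^k} ⋊ C_{p^j} = ⟨a, b | a^{p^k} = b^{p^j} = 1, b·a·b^{−1} = a^{p^{k−j}+1}⟩, i.e. the semidirect product of the cyclic group of order p^k by the cyclic group of order p^j in which the chosen generator b acts on the chosen generator a by a ↦ a^{p^{k−j}+1} (this is well defined since (p^{k−j}+1)^{p^j} ≡ 1 (mod p^k)). Then: (i) the center of G is the cyclic subgroup generated by a^{p^j}, which has order p^{k−j}; (ii) every faithful irreducible complex representation of G has dimension p^j; and (iii) the character of every faithful irreducible complex representation of G vanishes at every element outside the center. -/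
open CategoryTheory Finset

namespace FDRep

variable {G : Type} [Group G]

/-- Central elements act by scalars on a simple representation. -/
theorem exists_smul_one_of_mem_center (V : FDRep ℂ G) [Simple V] {z : G}
    (hz : z ∈ Subgroup.center G) : ∃ c : ℂ, V.ρ z = c • 1 := by
  let f : V ⟶ V := ⟨Action.ρ V z, fun g => by
    have h := congrArg (Action.ρ V) (Subgroup.mem_center_iff.mp hz g)
    rw [map_mul, map_mul] at h
    exact h.symm⟩
  obtain ⟨c, hc⟩ := endomorphism_simple_eq_smul_id ℂ f
  exact ⟨c, (congrArg (fun φ : V ⟶ V => φ.hom.hom.hom) hc).symm⟩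

theorem character_mul_of_eq_smul_one (V : FDRep ℂ G) {z : G} {c : ℂ} (hc : V.ρ z = c • 1)
    (g : G) : V.character (z * g) = c * V.character g := by
  simp [character, map_mul, hc]

/-- In a group all of whose commutators are central, the character of a faithful irreducible
representation vanishes off the center. -/
theorem character_eq_zero_of_notMem_center
    (hG : ∀ g h : G, h * g * h⁻¹ * g⁻¹ ∈ Subgroup.center G) (V : FDRep ℂ G)
    (hV : Function.Injective V.ρ) [Simple V] {g : G} (hg : g ∉ Subgroup.center G) :
    V.character g = 0 := by
  rw [Subgroup.mem_center_iff, not_forall] at hg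
  obtain ⟨h, hh⟩ := hg
  obtain ⟨c, hc⟩ := V.exists_smul_one_of_mem_center (hG g h)
  have hχ := V.character_mul_of_eq_smul_one hc g
  rw [inv_mul_cancel_right, char_conj] at hχ
  have hc1 : c ≠ 1 := by
    rintro rfl
    apply hh
    rw [one_smul, ← map_one V.ρ] at hc
    exact mul_inv_eq_iff_eq_mul.mp (mul_inv_eq_one.mp (hV hc))
  have : (c - 1) * V.character g = 0 := by linear_combination -hχ
  exact (mul_eq_zero.mp this).resolve_left (sub_ne_zero.mpr hc1)

/-- An irreducible representation whose character vanishes off the center has dimension the square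
root of the index of the center. -/
theorem card_center_mul_finrank_sq [Fintype G] (V : FDRep ℂ G) [Simple V]
    (hχ : ∀ g ∉ Subgroup.center G, V.character g = 0) :
    Nat.card (Subgroup.center G) * Module.finrank ℂ V ^ 2 = Nat.card G := by
  classical
  have hcard : (Nat.card G : ℂ) ≠ 0 := Nat.cast_ne_zero.mpr Nat.card_pos.ne'
  have : Invertible (Nat.card G : ℂ) := invertibleOfNonzero hcard
  have horth := char_orthonormal V V
  rw [if_pos ⟨Iso.refl V⟩, inv_mul_eq_one₀ hcard] at horth
  have hterm (g : G) : V.character g * V.character g⁻¹ =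
      if g ∈ Subgroup.center G then (Module.finrank ℂ V : ℂ) ^ 2 else 0 := by
    split_ifs with hg
    · obtain ⟨c, hc⟩ := V.exists_smul_one_of_mem_center hg
      have h1 := V.character_mul_of_eq_smul_one hc 1
      have h2 := V.character_mul_of_eq_smul_one hc g⁻¹
      rw [mul_one, char_one] at h1
      rw [mul_inv_cancel, char_one] at h2
      rw [h1]
      linear_combination -(Module.finrank ℂ V : ℂ) * h2
    · rw [hχ g hg, zero_mul]
  simp_rw [hterm] at horth
  rw [← Finset.sum_filter, Finset.sum_const, nsmul_eq_mul, ← Fintype.card_subtype,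
    ← Nat.card_eq_fintype_card] at horth
  exact_mod_cast horth.symm

end FDRep

section Metacyclic

variable {G : Type*} [Group G] {a b : G}

/-- If two generators commute with a given element, then that element is central. -/
theorem mem_center_of_closure_pair (hgen : Subgroup.closure {a, b} = ⊤) {x : G}
    (hxa : a * x = x * a) (hxb : b * x = x * b) : x ∈ Subgroup.center G := by
  have h : Subgroup.closure {a, b} ≤ Subgroup.centralizer {x} := by
    rw [Subgroup.closure_le]
    rintro y (rfl | rfl) <;> simpa [Subgroup.mem_centralizer_singleton_iff]
  rw [hgen] at h
  exact Subgroup.mem_center_iff.mpr fun y =>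
    Subgroup.mem_centralizer_singleton_iff.mp (h (Subgroup.mem_top y))

/-- If the commutator of two generators is central, then so are all commutators. -/
theorem commutator_mem_center_of_closure_pair (hgen : Subgroup.closure {a, b} = ⊤) {z : G}
    (hz : z ∈ Subgroup.center G) (hba : b * a = z * (a * b)) (g h : G) :
    h * g * h⁻¹ * g⁻¹ ∈ Subgroup.center G := by
  let π := QuotientGroup.mk' (Subgroup.center G)
  have hπz : π z = 1 := (QuotientGroup.eq_one_iff z).mpr hz
  have hπ : π b * π a = π a * π b := by
    rw [← map_mul, hba, map_mul, hπz, one_mul, map_mul]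
  have hgenπ : Subgroup.closure {π a, π b} = ⊤ := by
    rw [← Set.image_pair, ← MonoidHom.map_closure, hgen, ← MonoidHom.range_eq_map,
      MonoidHom.range_eq_top.mpr (QuotientGroup.mk'_surjective _)]
  have hcen : Subgroup.closure {π a, π b} ≤ Subgroup.center _ := by
    rw [Subgroup.closure_le]
    rintro y (rfl | rfl)
    · exact mem_center_of_closure_pair hgenπ rfl hπ
    · exact mem_center_of_closure_pair hgenπ hπ.symm rfl
  rw [hgenπ] at hcen
  rw [← QuotientGroup.eq_one_iff]
  change π (h * g * h⁻¹ * g⁻¹) = 1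
  simp only [map_mul, map_inv]
  rw [← Subgroup.mem_center_iff.mp (hcen (Subgroup.mem_top (π h))) (π g)]
  group

/-- In a finite group generated by `a` and `b`, where `b` conjugates `a` to a power of `a`, every
element is of the form `a ^ m * b ^ n`. -/
theorem exists_zpow_mul_zpow_of_closure_pair [Finite G] (hgen : Subgroup.closure {a, b} = ⊤) {r : ℕ}
    (hrel : b * a * b⁻¹ = a ^ r) (g : G) : ∃ m n : ℤ, a ^ m * b ^ n = g := by
  have hnorm : (Subgroup.zpowers a).Normal := by
    rw [← Subgroup.normalizer_eq_top_iff, eq_top_iff, ← hgen, Subgroup.closure_le]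
    rintro y (rfl | rfl)
    · exact Subgroup.le_normalizer (Subgroup.mem_zpowers y)
    · apply Subgroup.mem_normalizer_fintype
      rintro _ ⟨m, rfl⟩
      refine ⟨r * m, ?_⟩
      simp only
      rw [← conj_zpow, hrel, zpow_mul, zpow_natCast]
  have hsup : g ∈ Subgroup.zpowers a ⊔ Subgroup.zpowers b := by
    have : Subgroup.closure {a, b} ≤ Subgroup.zpowers a ⊔ Subgroup.zpowers b := by
      rw [Subgroup.closure_le]
      rintro y (rfl | rfl)
      · exact Subgroup.mem_sup_left (Subgroup.mem_zpowers y)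
      · exact Subgroup.mem_sup_right (Subgroup.mem_zpowers y)
    rw [hgen] at this
    exact this (Subgroup.mem_top g)
  obtain ⟨_, ⟨m, rfl⟩, _, ⟨n, rfl⟩, h⟩ := Subgroup.mem_sup_of_normal_left.mp hsup
  exact ⟨m, n, h⟩

/-- If every element is of the form `a ^ m * b ^ n`, then the order of the group is at most the
product of the orders of `a` and `b`. -/
theorem card_le_orderOf_mul_orderOf [Finite G] (h : ∀ g : G, ∃ m n : ℤ, a ^ m * b ^ n = g) :
    Nat.card G ≤ orderOf a * orderOf b := by
  rw [← Nat.card_zpowers, ← Nat.card_zpowers, ← Nat.card_prod]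
  refine Nat.card_le_card_of_surjective
    (fun x : Subgroup.zpowers a × Subgroup.zpowers b => (x.1 * x.2 : G)) fun g => ?_
  obtain ⟨m, n, rfl⟩ := h g
  exact ⟨⟨⟨a ^ m, m, rfl⟩, ⟨b ^ n, n, rfl⟩⟩, rfl⟩

/-- If `b * a = z * (a * b)` with `z` central and `a ^ m * b ^ n` is central, then the exponents are
divisible by the order of `z`. -/
theorem orderOf_dvd_of_zpow_mul_zpow_mem_center {z : G} (hz : z ∈ Subgroup.center G)
    (hba : b * a = z * (a * b)) {m n : ℤ} (h : a ^ m * b ^ n ∈ Subgroup.center G) :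
    (orderOf z : ℤ) ∣ m ∧ (orderOf z : ℤ) ∣ n := by
  have hzc (g : G) : Commute z g := (Subgroup.mem_center_iff.mp hz g).symm
  have hm : b * a ^ m * b⁻¹ = z ^ m * a ^ m := by
    rw [← conj_zpow, hba, ← (hzc a).mul_zpow]
    group
  have hn : a⁻¹ * b ^ n * a = z ^ n * b ^ n := by
    have hconj : a⁻¹ * b * a⁻¹⁻¹ = z * b := by
      rw [inv_inv, mul_assoc, hba, ← mul_assoc, ← (hzc a⁻¹).eq]
      group
    rw [← (hzc b).mul_zpow, ← hconj, conj_zpow, inv_inv]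
  have ha := Subgroup.mem_center_iff.mp h a
  have hb := Subgroup.mem_center_iff.mp h b
  constructor
  · rw [orderOf_dvd_iff_zpow_eq_one]
    have : b * a ^ m = a ^ m * b := by
      apply mul_right_cancel (b := b ^ n)
      rw [mul_assoc, hb, mul_assoc, mul_assoc, ← zpow_add_one, ← zpow_one_add, add_comm]
    rw [this, mul_inv_cancel_right] at hm
    simpa using hm.symm
  · rw [orderOf_dvd_iff_zpow_eq_one]
    have : b ^ n * a = a * b ^ n := by
      apply mul_left_cancel (a := a ^ m)
      rw [← mul_assoc, ← ha, ← mul_assoc, ← mul_assoc, ← zpow_one_add, ← zpow_add_one, add_comm]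
    rw [mul_assoc, this, inv_mul_cancel_left] at hn
    simpa using hn.symm

end Metacyclic

theorem stmt_13 (p : ℕ) (hp : p.Prime) (j k : ℕ) (hj : 0 < j) (hjk : 2 * j ≤ k)
    -- `G` is the semidirect product `C_{p^k} ⋊ C_{p^j}` with presentation
    -- `⟨a, b | a^{p^k} = b^{p^j} = 1, b a b⁻¹ = a^{p^{k-j}+1}⟩`:
    -- it is generated by `a` and `b` subject to these relations, and has order `p^{k+j}`
    (G : Type) [Group G] [Fintype G] (a b : G)
    (ha : a ^ p ^ k = 1) (hb : b ^ p ^ j = 1)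
    (hrel : b * a * b⁻¹ = a ^ (p ^ (k - j) + 1))
    (hgen : Subgroup.closure {a, b} = ⊤)
    (hcard : Fintype.card G = p ^ (k + j)) :
    -- (i) the center of `G` is generated by `a^{p^j}` and has order `p^{k-j}`
    (Subgroup.center G = Subgroup.zpowers (a ^ p ^ j) ∧
      orderOf (a ^ p ^ j) = p ^ (k - j)) ∧
    -- (ii) every faithful irreducible complex representation has dimension `p^j`
    (∀ V : FDRep ℂ G, Function.Injective V.ρ → Simple V →
      Module.finrank ℂ V = p ^ j) ∧
    -- (iii) the character of a faithful irreducible representation vanishes off the center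
    (∀ V : FDRep ℂ G, Function.Injective V.ρ → Simple V →
      ∀ g : G, g ∉ Subgroup.center G → V.character g = 0) := by
  have hnf := exists_zpow_mul_zpow_of_closure_pair hgen hrel
  have hoa : orderOf a = p ^ k := by
    refine le_antisymm (Nat.le_of_dvd (pow_pos hp.pos _) (orderOf_dvd_of_pow_eq_one ha)) ?_
    have hob := Nat.le_of_dvd (pow_pos hp.pos _) (orderOf_dvd_of_pow_eq_one hb)
    have hle := card_le_orderOf_mul_orderOf hnf
    rw [Nat.card_eq_fintype_card, hcard, pow_add] at hle
    exact le_of_mul_le_mul_right (hle.trans (Nat.mul_le_mul_left _ hob)) (pow_pos hp.pos j)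
  have horder : ∀ i ≤ k, orderOf (a ^ p ^ i) = p ^ (k - i) := fun i hi => by
    rw [orderOf_pow_of_dvd (pow_pos hp.pos _).ne' (hoa ▸ pow_dvd_pow p hi), hoa,
      Nat.pow_div hi hp.pos]
  have hcen : a ^ p ^ j ∈ Subgroup.center G := by
    refine mem_center_of_closure_pair hgen (pow_mul_comm' a _).symm ?_
    rw [← mul_inv_eq_iff_eq_mul, ← conj_pow, hrel, ← pow_mul, add_mul, ← pow_add, one_mul,
      Nat.sub_add_cancel (by omega), pow_add, ha, one_mul]
  have hz : a ^ p ^ (k - j) ∈ Subgroup.center G := by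
    have := pow_mem hcen (p ^ (k - j - j))
    rwa [← pow_mul, ← pow_add, Nat.add_sub_cancel' (by omega)] at this
  have hba : b * a = a ^ p ^ (k - j) * (a * b) := by
    rw [← mul_assoc, ← pow_succ, ← hrel, inv_mul_cancel_right]
  have hcenter : Subgroup.center G = Subgroup.zpowers (a ^ p ^ j) := by
    refine le_antisymm (fun g hg => ?_) (Subgroup.zpowers_le.mpr hcen)
    obtain ⟨m, n, rfl⟩ := hnf g
    obtain ⟨⟨m, rfl⟩, ⟨n, rfl⟩⟩ := orderOf_dvd_of_zpow_mul_zpow_mem_center hz hba hg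
    rw [horder _ (by omega), Nat.sub_sub_self (by omega), zpow_mul, zpow_mul, zpow_natCast,
      zpow_natCast, hb, one_zpow, mul_one]
    exact Subgroup.zpow_mem_zpowers _ _
  have hcomm := commutator_mem_center_of_closure_pair hgen hz hba
  refine ⟨⟨hcenter, horder j (by omega)⟩, fun V hV _ => ?_, fun V hV _ g hg =>
    V.character_eq_zero_of_notMem_center hcomm hV hg⟩
  have hdim := V.card_center_mul_finrank_sq fun g hg =>
    V.character_eq_zero_of_notMem_center hcomm hV hg
  rw [hcenter, Nat.card_zpowers, horder j (by omega), Nat.card_eq_fintype_card, hcard,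
    show k + j = k - j + j * 2 by omega, pow_add, pow_mul] at hdim
  exact Nat.pow_left_injective two_ne_zero (Nat.eq_of_mul_eq_mul_left (pow_pos hp.pos _) hdim)
end
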